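/- arXiv:q-alg/9504002 — 2 statements merged into one kernel-verified Lean document; each statement's English description precedes it below -/
import Mathlib

section
/- Let k be an algebraically closed field of characteristic zero and b a quadratic Poisson bracket on A = k[x₁,x₂,x₃], with b(x_i,x_j) = Σ_{p,q} c_{ij}^{pq} x_p x_q. Let R be the free associative algebra over k[[ħ]] on generators a₁,a₂,a₃, and let R_b be the quotient of R by the two-sided ideal generated by the three elements a_i a_j − a_j a_i − ħ·Σ_{p,q} c_{ij}^{pq}·(a_p a_q + a_q a_p)/2 for 1 ≤ i < j ≤ 3. Then the images of the standard monomials a₁^{m₁} a₂^{m₂} a₃^{m₃} (m₁,m₂,m₃ ≥ 0) form a basis of R_b as a k[[ħ]]-module; in particular R_b is a flat deformation of the polynomial algebra A realizing the bracket b (R_b/ħR_b ≅ A, and the bracket induced by (uv − vu)/ħ reduces to b modulo ħ). -/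
open MvPolynomial

/-- The quadratic bracket on `k[x₁,x₂,x₃]` determined by the family `y i j = b(xᵢ, xⱼ)`. -/
noncomputable def qBracket {k : Type*} [CommRing k] {n : ℕ}
    (y : Fin n → Fin n → MvPolynomial (Fin n) k)
    (f g : MvPolynomial (Fin n) k) : MvPolynomial (Fin n) k :=
  ∑ i, ∑ j, y i j * pderiv i f * pderiv j g

/-- The defining relations of the quantized algebra `R_b`:
`aᵢaⱼ = aⱼaᵢ + ħ ∑ c i j p q (a_p a_q + a_q a_p)/2` for `i < j`. -/
inductive QuantRel {k : Type*} [Field k] (c : Fin 3 → Fin 3 → Fin 3 → Fin 3 → k) :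
    FreeAlgebra (PowerSeries k) (Fin 3) → FreeAlgebra (PowerSeries k) (Fin 3) → Prop
  | rel (i j : Fin 3) (hij : i < j) :
      QuantRel c (FreeAlgebra.ι (PowerSeries k) i * FreeAlgebra.ι (PowerSeries k) j)
        (FreeAlgebra.ι (PowerSeries k) j * FreeAlgebra.ι (PowerSeries k) i +
          ∑ p, ∑ q, (PowerSeries.X * PowerSeries.C (c i j p q / 2)) •
            (FreeAlgebra.ι (PowerSeries k) p * FreeAlgebra.ι (PowerSeries k) q +
              FreeAlgebra.ι (PowerSeries k) q * FreeAlgebra.ι (PowerSeries k) p))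

/-- The quantized algebra `R_b`, the quotient of the free `k[[ħ]]`-algebra on three
generators by the relations `[aᵢ,aⱼ] = ħ ∑ c i j p q (a_p ∘ a_q)`. -/
abbrev QuantAlg (k : Type*) [Field k] (c : Fin 3 → Fin 3 → Fin 3 → Fin 3 → k) : Type _ :=
  RingQuot (QuantRel c)

/-- The Levi-Civita symbol on three indices. -/
def leviCivita (k : Type*) [Field k] (i j l : Fin 3) : k :=
  (((j : ℕ) : k) - (i : ℕ)) * (((l : ℕ) : k) - (j : ℕ)) * (((l : ℕ) : k) - (i : ℕ)) / 2

section LeviCivita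

variable {k : Type*} [Field k]

theorem leviCivita_cyclic (i j l : Fin 3) : leviCivita k j l i = leviCivita k i j l := by
  unfold leviCivita; ring

@[simp] theorem leviCivita_same_left (i j : Fin 3) : leviCivita k i i j = 0 := by
  simp [leviCivita]

@[simp] theorem leviCivita_same_right (i j : Fin 3) : leviCivita k i j j = 0 := by
  simp [leviCivita]

@[simp] theorem leviCivita_same_outer (i j : Fin 3) : leviCivita k i j i = 0 := by
  simp [leviCivita]

variable [CharZero k]

@[simp] theorem leviCivita_zero_one_two : leviCivita k 0 1 2 = 1 := by
  norm_num [leviCivita]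

@[simp] theorem leviCivita_one_two_zero : leviCivita k 1 2 0 = 1 := by
  norm_num [leviCivita]

@[simp] theorem leviCivita_two_zero_one : leviCivita k 2 0 1 = 1 := by
  norm_num [leviCivita]

@[simp] theorem leviCivita_zero_two_one : leviCivita k 0 2 1 = -1 := by
  norm_num [leviCivita]

@[simp] theorem leviCivita_two_one_zero : leviCivita k 2 1 0 = -1 := by
  norm_num [leviCivita]

@[simp] theorem leviCivita_one_zero_two : leviCivita k 1 0 2 = -1 := by
  norm_num [leviCivita]

end LeviCivita

section Scalar

variable {k : Type*} [Field k] [CharZero k]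

/-- The action of the linear vector field `D` on the symmetric cubic tensor `f`. -/
def cubicAction (f : Fin 3 → Fin 3 → Fin 3 → k) (D : Fin 3 → Fin 3 → k) (a b m : Fin 3) : k :=
  ∑ q, (f q a b * D q m + f q b m * D q a + f q a m * D q b)

/-- The contraction of a cubic tensor with a matrix through the Levi-Civita symbol. -/
def cubicTwist (f : Fin 3 → Fin 3 → Fin 3 → k) (D : Fin 3 → Fin 3 → k) (q l : Fin 3) : k :=
  ∑ i, ∑ m, ∑ u, leviCivita k q i m * D u i * f u m l

theorem cubicTwist_zero (f : Fin 3 → Fin 3 → Fin 3 → k) (D : Fin 3 → Fin 3 → k) (l : Fin 3) :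
    cubicTwist f D 0 l = ∑ u, (D u 1 * f u 2 l - D u 2 * f u 1 l) := by
  simp [cubicTwist, Fin.sum_univ_three]; ring

theorem cubicTwist_one (f : Fin 3 → Fin 3 → Fin 3 → k) (D : Fin 3 → Fin 3 → k) (l : Fin 3) :
    cubicTwist f D 1 l = ∑ u, (D u 2 * f u 0 l - D u 0 * f u 2 l) := by
  simp [cubicTwist, Fin.sum_univ_three]; ring

theorem cubicTwist_two (f : Fin 3 → Fin 3 → Fin 3 → k) (D : Fin 3 → Fin 3 → k) (l : Fin 3) :
    cubicTwist f D 2 l = ∑ u, (D u 0 * f u 1 l - D u 1 * f u 0 l) := by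
  simp [cubicTwist, Fin.sum_univ_three]; ring

set_option maxHeartbeats 8000000 in
/-- If `D` annihilates `f`, then applying the twist twice to `D` gives a matrix `G` such that
`G v` and `D v` are collinear for every vector `v`. -/
theorem cubicTwist_cubicTwist_cross
    (f : Fin 3 → Fin 3 → Fin 3 → k) (D : Fin 3 → Fin 3 → k)
    (hf₁ : ∀ a b c, f a b c = f b a c) (hf₂ : ∀ a b c, f a b c = f a c b)
    (hD : D 2 2 = -D 0 0 - D 1 1) (hJ : ∀ a b m, cubicAction f D a b m = 0)
    (c j l : Fin 3) :
    cubicTwist f (cubicTwist f D) (c + 1) j * D (c + 2) l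
      + cubicTwist f (cubicTwist f D) (c + 1) l * D (c + 2) j
      - cubicTwist f (cubicTwist f D) (c + 2) j * D (c + 1) l
      - cubicTwist f (cubicTwist f D) (c + 2) l * D (c + 1) j = 0 := by
  have certificate :
      cubicTwist f (cubicTwist f D) (c + 1) j * D (c + 2) l
        + cubicTwist f (cubicTwist f D) (c + 1) l * D (c + 2) j
        - cubicTwist f (cubicTwist f D) (c + 2) j * D (c + 1) l
        - cubicTwist f (cubicTwist f D) (c + 2) l * D (c + 1) j
      = ∑ p, ∑ s, (
          (D s (p + 2) * (- f c j p * cubicAction f D l (p + 1) s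
            - f c l p * cubicAction f D j (p + 1) s
            + 1 / 3 * f j p s * cubicAction f D c l (p + 1)
            + 1 / 3 * f l p s * cubicAction f D c j (p + 1)
            - 2 / 3 * f c p s * cubicAction f D j l (p + 1)))
          - (D s (p + 1) * (- f c j p * cubicAction f D l (p + 2) s
            - f c l p * cubicAction f D j (p + 2) s
            + 1 / 3 * f j p s * cubicAction f D c l (p + 2)
            + 1 / 3 * f l p s * cubicAction f D c j (p + 2)
            - 2 / 3 * f c p s * cubicAction f D j l (p + 2)))) := by
    have h₁ : (1 : Fin 3) + 2 = 0 := rfl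
    have h₂ : (2 : Fin 3) + 1 = 0 := rfl
    have h₃ : (2 : Fin 3) + 2 = 1 := rfl
    have h₄ : (1 : Fin 3) + 1 = 2 := rfl
    have s₁ : ∀ a, f a 1 0 = f a 0 1 := fun a => hf₂ _ _ _
    have s₂ : ∀ a, f a 2 0 = f a 0 2 := fun a => hf₂ _ _ _
    have s₃ : ∀ a, f a 2 1 = f a 1 2 := fun a => hf₂ _ _ _
    have t₁ : ∀ a, f 1 0 a = f 0 1 a := fun a => hf₁ _ _ _
    have t₂ : ∀ a, f 2 0 a = f 0 2 a := fun a => hf₁ _ _ _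
    have t₃ : ∀ a, f 2 1 a = f 1 2 a := fun a => hf₁ _ _ _
    fin_cases c <;> fin_cases j <;> fin_cases l <;>
      simp only [Fin.zero_eta, Fin.mk_one, Fin.reduceFinMk, zero_add, h₁, h₂, h₃, h₄,
        cubicTwist_zero, cubicTwist_one, cubicTwist_two, cubicAction, Fin.sum_univ_three,
        s₁, s₂, s₃, t₁, t₂, t₃, hD] <;> ring
  simp [certificate, hJ]

/-- If `D` has two independent columns and `N v`, `D v` are collinear for all `v`, then `N` is a
multiple of `D`. -/
theorem exists_eq_mul_of_cross_eq_zero (N D : Fin 3 → Fin 3 → k)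
    (hcross : ∀ a b j l, N a j * D b l + N a l * D b j - N b j * D a l - N b l * D a j = 0)
    {a b j l : Fin 3} (hd : D a j * D b l - D b j * D a l ≠ 0) :
    ∃ t : k, ∀ q m, N q m = t * D q m := by
  have hdiag : ∀ a b j, N a j * D b j = N b j * D a j := fun a b j => by
    have h2 : (2 : k) ≠ 0 := two_ne_zero
    apply mul_left_cancel₀ h2
    linear_combination hcross a b j j
  have eq_zero : ∀ z : Fin 3 → k, (∀ p q, z p * D q j = z q * D p j) →
      (∀ p q, z p * D q l = z q * D p l) → ∀ q, z q = 0 := fun z hj hl q => by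
    apply (mul_eq_zero.mp _).resolve_left hd
    linear_combination D b l * hj q a - D a l * hj q b + D q j * hl a b
  obtain ⟨r, hr⟩ : ∃ r, D r j ≠ 0 := by
    by_contra! h
    exact hd (by rw [h a, h b]; ring)
  obtain ⟨t, ht⟩ : ∃ t, N r j = t * D r j := ⟨N r j / D r j, by field_simp⟩
  have hj : ∀ q, N q j = t * D q j := fun q => by
    apply mul_right_cancel₀ hr
    linear_combination hdiag q r j + D q j * ht
  have hl : ∀ q, N q l = t * D q l := fun q => by
    refine sub_eq_zero.mp (eq_zero (fun q => N q l - t * D q l) ?_ ?_ q)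
    · intro p q
      linear_combination hcross p q j l - D q l * hj p + D p l * hj q
    · intro p q
      linear_combination hdiag p q l
  refine ⟨t, fun q m => sub_eq_zero.mp (eq_zero (fun q => N q m - t * D q m) ?_ ?_ q)⟩
  · intro p q
    linear_combination hcross p q j m - D q m * hj p + D p m * hj q
  · intro p q
    linear_combination hcross p q l m - D q m * hl p + D p m * hl q

/-- If a rank one matrix `D` annihilates `f`, then its twist by `f` vanishes. -/
theorem cubicTwist_eq_zero_of_minors (f : Fin 3 → Fin 3 → Fin 3 → k) (D : Fin 3 → Fin 3 → k)
    (hf₂ : ∀ a b c, f a b c = f a c b)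
    (hJ : ∀ a b m, cubicAction f D a b m = 0)
    (hminor : ∀ a b j l, D a j * D b l - D b j * D a l = 0) :
    cubicTwist f D = 0 := by
  by_cases hD : D = 0
  · ext q l
    simp [cubicTwist, hD]
  obtain ⟨e, he⟩ := Function.ne_iff.mp hD
  obtain ⟨g, hg⟩ := Function.ne_iff.mp he
  replace hg : D e g ≠ 0 := hg
  set χ : Fin 3 → Fin 3 → k := fun a b => ∑ q, D q g * f q a b with hχ
  have χsymm : ∀ a b, χ a b = χ b a := fun a b => by
    simp only [hχ]
    exact Finset.sum_congr rfl fun q _ => by rw [hf₂]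
  have hcontract : ∀ i a b, D e g * ∑ q, D q i * f q a b = D e i * χ a b := fun i a b => by
    simp only [hχ, Finset.mul_sum]
    refine Finset.sum_congr rfl fun q _ => ?_
    linear_combination f q a b * hminor e q g i
  have hsymm : ∀ a b m, D e m * χ a b + D e a * χ b m + D e b * χ a m = 0 := fun a b m => by
    rw [← hcontract, ← hcontract, ← hcontract, ← mul_add, ← mul_add, ← Finset.sum_add_distrib,
      ← Finset.sum_add_distrib]
    have := hJ a b m
    simp only [cubicAction, mul_comm (f _ _ _)] at this
    rw [this, mul_zero]
  have h₁ : χ g g = 0 := by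
    have h3 : (3 : k) ≠ 0 := three_ne_zero
    apply (mul_eq_zero.mp _).resolve_left (mul_ne_zero h3 hg)
    linear_combination hsymm g g g
  have h₂ : ∀ b, χ g b = 0 := fun b => by
    apply (mul_eq_zero.mp _).resolve_left (mul_ne_zero two_ne_zero hg)
    linear_combination hsymm g b g - D e b * h₁ - D e g * χsymm b g
  have h₃ : ∀ a b, χ a b = 0 := fun a b => by
    apply (mul_eq_zero.mp _).resolve_left hg
    linear_combination hsymm a b g - D e a * χsymm b g - D e a * h₂ b - D e b * χsymm a g
      - D e b * h₂ a
  have h₄ : ∀ i a b, ∑ q, D q i * f q a b = 0 := fun i a b => by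
    apply (mul_eq_zero.mp _).resolve_left hg
    rw [hcontract, h₃, mul_zero]
  ext q l
  simp only [cubicTwist, mul_assoc, ← Finset.mul_sum, h₄, mul_zero, Finset.sum_const_zero,
    Pi.zero_apply]

/-- A traceless matrix `D` annihilating the cubic tensor `f` is an eigenvector of the square of
the twist by `f`. -/
theorem exists_cubicTwist_cubicTwist_eq
    (f : Fin 3 → Fin 3 → Fin 3 → k) (D : Fin 3 → Fin 3 → k)
    (hf₁ : ∀ a b c, f a b c = f b a c) (hf₂ : ∀ a b c, f a b c = f a c b)
    (hD : D 2 2 = -D 0 0 - D 1 1) (hJ : ∀ a b m, cubicAction f D a b m = 0) :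
    ∃ t : k, ∀ q m, cubicTwist f (cubicTwist f D) q m = t * D q m := by
  by_cases hminor : ∀ a b j l, D a j * D b l - D b j * D a l = 0
  · refine ⟨0, fun q m => ?_⟩
    rw [cubicTwist_eq_zero_of_minors f D hf₂ hJ hminor]
    simp [cubicTwist]
  · push Not at hminor
    obtain ⟨a, b, j, l, hd⟩ := hminor
    refine exists_eq_mul_of_cross_eq_zero _ D (fun a b j l => ?_) hd
    have h₀ := cubicTwist_cubicTwist_cross f D hf₁ hf₂ hD hJ 0 j l
    have h₁ := cubicTwist_cubicTwist_cross f D hf₁ hf₂ hD hJ 1 j l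
    have h₂ := cubicTwist_cubicTwist_cross f D hf₁ hf₂ hD hJ 2 j l
    rw [show (1 : Fin 3) + 1 = 2 from rfl, show (1 : Fin 3) + 2 = 0 from rfl] at h₁
    rw [show (2 : Fin 3) + 1 = 0 from rfl, show (2 : Fin 3) + 2 = 1 from rfl] at h₂
    rw [zero_add, zero_add] at h₀
    fin_cases a <;> fin_cases b <;>
      simp only [Fin.zero_eta, Fin.mk_one, Fin.reduceFinMk] <;>
      first
        | ring1
        | linear_combination h₀
        | linear_combination h₁
        | linear_combination h₂
        | linear_combination -h₀
        | linear_combination -h₁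
        | linear_combination -h₂

/-- The quadratic vector `y` assembled from the cubic tensor `f` and the matrix `D`: the
gradient of `f` plus the cross product of `x` and `D x`. -/
def quadPart (f : Fin 3 → Fin 3 → Fin 3 → k) (D : Fin 3 → Fin 3 → k) (q i m : Fin 3) : k :=
  f q i m + 1 / 2 * ∑ u, (leviCivita k q i u * D u m + leviCivita k q m u * D u i)

theorem quadPart_symm (f : Fin 3 → Fin 3 → Fin 3 → k) (D : Fin 3 → Fin 3 → k)
    (hf₂ : ∀ a b c, f a b c = f a c b) (q i m : Fin 3) :
    quadPart f D q i m = quadPart f D q m i := by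
  simp only [quadPart, hf₂ q i m]
  simp only [add_comm]

/-- The second order term of the twist. -/
def twistPart (f : Fin 3 → Fin 3 → Fin 3 → k) (D : Fin 3 → Fin 3 → k) (t : k) (q m : Fin 3) : k :=
  -(1 / 2) * cubicTwist f D q m + 3 / 4 * ∑ u, D q u * D u m
    + (t / 3 - 1 / 8 * ∑ u, ∑ v, D u v * D v u) * if q = m then 1 else 0

set_option maxHeartbeats 2000000 in
theorem twistPart_curl
    (f : Fin 3 → Fin 3 → Fin 3 → k) (D : Fin 3 → Fin 3 → k)
    (hf₁ : ∀ a b c, f a b c = f b a c) (hf₂ : ∀ a b c, f a b c = f a c b)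
    (hD : D 2 2 = -D 0 0 - D 1 1) (hJ : ∀ a b m, cubicAction f D a b m = 0)
    (t : k) (ht : ∀ q m, cubicTwist f (cubicTwist f D) q m = t * D q m) (c m : Fin 3) :
    ∑ q, twistPart f D t q (c + 1) * quadPart f D q (c + 2) m =
      ∑ q, twistPart f D t q (c + 2) * quadPart f D q (c + 1) m := by
  have certificate :
      ∑ q, twistPart f D t q (c + 1) * quadPart f D q (c + 2) m
        - ∑ q, twistPart f D t q (c + 2) * quadPart f D q (c + 1) m
      = -(1 / 2) * (cubicTwist f (cubicTwist f D) c m - t * D c m)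
        - 1 / 2 * ∑ s, (D s (c + 2) * cubicAction f D (c + 1) s m
          - D s (c + 1) * cubicAction f D (c + 2) s m) := by
    have h₁ : (1 : Fin 3) + 2 = 0 := rfl
    have h₂ : (2 : Fin 3) + 1 = 0 := rfl
    have h₃ : (2 : Fin 3) + 2 = 1 := rfl
    have h₄ : (1 : Fin 3) + 1 = 2 := rfl
    have s₁ : ∀ a, f a 1 0 = f a 0 1 := fun a => hf₂ _ _ _
    have s₂ : ∀ a, f a 2 0 = f a 0 2 := fun a => hf₂ _ _ _
    have s₃ : ∀ a, f a 2 1 = f a 1 2 := fun a => hf₂ _ _ _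
    have t₁ : ∀ a, f 1 0 a = f 0 1 a := fun a => hf₁ _ _ _
    have t₂ : ∀ a, f 2 0 a = f 0 2 a := fun a => hf₁ _ _ _
    have t₃ : ∀ a, f 2 1 a = f 1 2 a := fun a => hf₁ _ _ _
    fin_cases c <;> fin_cases m <;>
      simp [h₁, h₂, h₃, h₄, twistPart, quadPart, cubicTwist_zero, cubicTwist_one,
        cubicTwist_two, cubicAction, Fin.sum_univ_three, s₁, s₂, s₃, t₁, t₂, t₃, hD] <;>
      ring
  refine sub_eq_zero.mp (certificate.trans ?_)
  simp [ht, hJ]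

set_option maxHeartbeats 2000000 in
/-- Order by order form of the twisted superpotential identity. -/
theorem exists_twist_of_cubic
    (f : Fin 3 → Fin 3 → Fin 3 → k) (D : Fin 3 → Fin 3 → k)
    (hf₁ : ∀ a b c, f a b c = f b a c) (hf₂ : ∀ a b c, f a b c = f a c b)
    (hD : D 2 2 = -D 0 0 - D 1 1) (hJ : ∀ a b m, cubicAction f D a b m = 0) :
    ∃ P₁ P₂ : Fin 3 → Fin 3 → k,
      (∀ i m l, ∑ q, (P₁ q l * leviCivita k q i m + P₁ q i * leviCivita k q m l) =
        quadPart f D l i m - quadPart f D i m l) ∧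
      (∀ i m l, ∑ q, (P₂ q l * leviCivita k q i m - P₂ q i * leviCivita k q m l) =
        ∑ q, (P₁ q l * quadPart f D q i m + P₁ q i * quadPart f D q m l)) ∧
      (∀ i m l, ∑ q, P₂ q l * quadPart f D q i m = ∑ q, P₂ q i * quadPart f D q m l) := by
  obtain ⟨t, ht⟩ := exists_cubicTwist_cubicTwist_eq f D hf₁ hf₂ hD hJ
  have s₁ : ∀ a, f a 1 0 = f a 0 1 := fun a => hf₂ _ _ _
  have s₂ : ∀ a, f a 2 0 = f a 0 2 := fun a => hf₂ _ _ _
  have s₃ : ∀ a, f a 2 1 = f a 1 2 := fun a => hf₂ _ _ _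
  have t₁ : ∀ a, f 1 0 a = f 0 1 a := fun a => hf₁ _ _ _
  have t₂ : ∀ a, f 2 0 a = f 0 2 a := fun a => hf₁ _ _ _
  have t₃ : ∀ a, f 2 1 a = f 1 2 a := fun a => hf₁ _ _ _
  refine ⟨fun q m => -(3 / 2) * D q m, twistPart f D t, ?_, ?_, ?_⟩
  · intro i m l
    fin_cases i <;> fin_cases m <;> fin_cases l <;>
      simp [quadPart, Fin.sum_univ_three, s₁, s₂, s₃, t₁, t₂, t₃, hD] <;> ring
  · intro i m l
    have h := hJ i m l
    fin_cases i <;> fin_cases m <;> fin_cases l <;>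
      simp [quadPart, twistPart, Fin.sum_univ_three, cubicTwist_zero, cubicTwist_one, cubicTwist_two,
        cubicAction, s₁, s₂, s₃, t₁, t₂, t₃, hD] at h ⊢ <;>
      linear_combination h
  · intro i m l
    have h := fun c => twistPart_curl f D hf₁ hf₂ hD hJ t ht c m
    have h₀ := h 0
    have h₁ := h 1
    have h₂ := h 2
    rw [show (1 : Fin 3) + 1 = 2 from rfl, show (1 : Fin 3) + 2 = 0 from rfl] at h₁
    rw [show (2 : Fin 3) + 1 = 0 from rfl, show (2 : Fin 3) + 2 = 1 from rfl] at h₂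
    rw [zero_add, zero_add] at h₀
    simp only [quadPart_symm f D hf₂ _ m l]
    fin_cases i <;> fin_cases l <;>
      simp only [Fin.zero_eta, Fin.mk_one, Fin.reduceFinMk] <;>
      first
        | rfl
        | exact h₀
        | exact h₁
        | exact h₂
        | exact h₀.symm
        | exact h₁.symm
        | exact h₂.symm

end Scalar

section Curl

variable {k : Type*} [Field k] [CharZero k]

/-- The curl of the vector of quadratic forms with symmetric coefficients `Y`, up to a factor. -/
def quadCurl (Y : Fin 3 → Fin 3 → Fin 3 → k) (q m : Fin 3) : k :=
  ∑ l, ∑ i, leviCivita k q l i * Y l i m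

/-- The pairing of the vector of quadratic forms `Y` with its curl. -/
def curlPairing (Y : Fin 3 → Fin 3 → Fin 3 → k) (x : Fin 3 → k) : k :=
  ∑ q, (∑ m, quadCurl Y q m * x m) * ∑ a, ∑ b, Y q a b * x a * x b

set_option maxHeartbeats 2000000 in
theorem cubicAction_quadCurl (Y : Fin 3 → Fin 3 → Fin 3 → k)
    (hY : ∀ q a b, Y q a b = Y q b a) (a b m : Fin 3) :
    cubicAction Y (quadCurl Y) a b m = 1 / 2 * (
      curlPairing Y (Pi.single a 1 + Pi.single b 1 + Pi.single m 1)
      - curlPairing Y (Pi.single a 1 + Pi.single b 1)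
      - curlPairing Y (Pi.single a 1 + Pi.single m 1)
      - curlPairing Y (Pi.single b 1 + Pi.single m 1)
      + curlPairing Y (Pi.single a 1) + curlPairing Y (Pi.single b 1)
      + curlPairing Y (Pi.single m 1)) := by
  have s₁ : ∀ a, Y a 1 0 = Y a 0 1 := fun a => hY _ _ _
  have s₂ : ∀ a, Y a 2 0 = Y a 0 2 := fun a => hY _ _ _
  have s₃ : ∀ a, Y a 2 1 = Y a 1 2 := fun a => hY _ _ _
  simp only [curlPairing, cubicAction]
  generalize quadCurl Y = Z
  fin_cases a <;> fin_cases b <;> fin_cases m <;>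
    simp [Fin.sum_univ_three, Pi.single_apply, s₁, s₂, s₃] <;> ring

set_option maxHeartbeats 2000000 in
/-- A vector of quadratic forms orthogonal to its curl admits a second order twist. -/
theorem exists_twist_of_curlPairing (Y : Fin 3 → Fin 3 → Fin 3 → k)
    (hY : ∀ q a b, Y q a b = Y q b a) (hF : ∀ x, curlPairing Y x = 0) :
    ∃ P₁ P₂ : Fin 3 → Fin 3 → k,
      (∀ i m l, ∑ q, (P₁ q l * leviCivita k q i m + P₁ q i * leviCivita k q m l) =
        Y l i m - Y i m l) ∧
      (∀ i m l, ∑ q, (P₂ q l * leviCivita k q i m - P₂ q i * leviCivita k q m l) =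
        ∑ q, (P₁ q l * Y q i m + P₁ q i * Y q m l)) ∧
      (∀ i m l, ∑ q, P₂ q l * Y q i m = ∑ q, P₂ q i * Y q m l) := by
  have s₁ : ∀ a, Y a 1 0 = Y a 0 1 := fun a => hY _ _ _
  have s₂ : ∀ a, Y a 2 0 = Y a 0 2 := fun a => hY _ _ _
  have s₃ : ∀ a, Y a 2 1 = Y a 1 2 := fun a => hY _ _ _
  set f : Fin 3 → Fin 3 → Fin 3 → k := fun a b c => (Y a b c + Y b c a + Y c a b) / 3 with hf
  set D : Fin 3 → Fin 3 → k := fun q m => 2 / 3 * quadCurl Y q m with hDdef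
  have hquad : quadPart f D = Y := by
    ext q i m
    fin_cases q <;> fin_cases i <;> fin_cases m <;>
      simp [quadPart, hf, hDdef, quadCurl, Fin.sum_univ_three, s₁, s₂, s₃] <;> ring
  have hJ : ∀ a b m, cubicAction f D a b m = 0 := by
    intro a b m
    have h : cubicAction Y (quadCurl Y) a b m = 0 := by
      rw [cubicAction_quadCurl Y hY]
      simp [hF]
    fin_cases a <;> fin_cases b <;> fin_cases m <;>
      simp [cubicAction, hf, hDdef, quadCurl, Fin.sum_univ_three, s₁, s₂, s₃] at h ⊢ <;>
      linear_combination (2 / 3) * h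
  have hf₁ : ∀ a b c, f a b c = f b a c := fun a b c => by
    simp only [hf]; rw [hY a b c, hY b c a, hY c a b]; ring
  have hf₂ : ∀ a b c, f a b c = f a c b := fun a b c => by
    simp only [hf]; rw [hY a b c, hY b c a, hY c a b]; ring
  have hD : D 2 2 = -D 0 0 - D 1 1 := by
    simp [hDdef, quadCurl, Fin.sum_univ_three, s₁, s₂, s₃]; ring
  have := exists_twist_of_cubic f D hf₁ hf₂ hD hJ
  rwa [hquad] at this

end Curl

section Presentation

theorem sum_smul_commutator_sub_symm {K B : Type*} [CommRing K] [Ring B] [Algebra K B]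
    (b : Fin 3 → B) (e : Fin 3 → Fin 3 → K) (i j : Fin 3) :
    ∑ p, ∑ q, (((if p = i then if q = j then 1 else 0 else 0)
        - (if p = j then if q = i then 1 else 0 else 0)) - (e p q + e q p)) • (b p * b q) =
      b i * b j - b j * b i - ∑ p, ∑ q, e p q • (b p * b q + b q * b p) := by
  simp only [sub_smul, add_smul, smul_add, Finset.sum_sub_distrib, Finset.sum_add_distrib]
  rw [Finset.sum_comm (f := fun p q => e q p • (b p * b q))]
  simp [ite_smul]

variable {k : Type*} [Field k]

/-- The symmetrized coefficients of the quadratic forms `y 1 2`, `-y 0 2`, `y 0 1`. -/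
def symCoeff (c : Fin 3 → Fin 3 → Fin 3 → Fin 3 → k) (q i m : Fin 3) : k :=
  ![c 1 2 i m / 2 + c 1 2 m i / 2, -(c 0 2 i m / 2 + c 0 2 m i / 2),
    c 0 1 i m / 2 + c 0 1 m i / 2] q

theorem symCoeff_symm (c : Fin 3 → Fin 3 → Fin 3 → Fin 3 → k) (q i m : Fin 3) :
    symCoeff c q i m = symCoeff c q m i := by
  fin_cases q <;> simp [symCoeff, add_comm]

/-- The coefficients of the defining relations of the quantized algebra. -/
noncomputable def quantCoeff (c : Fin 3 → Fin 3 → Fin 3 → Fin 3 → k) (q i m : Fin 3) :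
    PowerSeries k :=
  PowerSeries.C (leviCivita k q i m) - PowerSeries.X * PowerSeries.C (symCoeff c q i m)

/-- The generators of the quantized algebra. -/
noncomputable def quantGen (c : Fin 3 → Fin 3 → Fin 3 → Fin 3 → k) (i : Fin 3) : QuantAlg k c :=
  RingQuot.mkAlgHom (PowerSeries k) (QuantRel c) (FreeAlgebra.ι (PowerSeries k) i)

variable (c : Fin 3 → Fin 3 → Fin 3 → Fin 3 → k)

theorem quantAlg_induction {motive : QuantAlg k c → Prop}
    (scalar : ∀ s : PowerSeries k, motive (algebraMap _ _ s))
    (gen : ∀ i, motive (quantGen c i))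
    (add : ∀ x y, motive x → motive y → motive (x + y))
    (mul : ∀ x y, motive x → motive y → motive (x * y)) (x : QuantAlg k c) : motive x := by
  obtain ⟨x, rfl⟩ := RingQuot.mkAlgHom_surjective (PowerSeries k) (QuantRel c) x
  induction x using FreeAlgebra.induction with
  | grade0 s => simpa only [AlgHom.commutes] using scalar s
  | grade1 i => exact gen i
  | mul x y hx hy => rw [map_mul]; exact mul _ _ hx hy
  | add x y hx hy => rw [map_add]; exact add _ _ hx hy

/-- The relator attached to a pair of generators. -/
theorem quantCoeff_relator {B : Type*} [Ring B] [Algebra (PowerSeries k) B] (b : Fin 3 → B)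
    (q i j : Fin 3) (s : PowerSeries k)
    (hq : ∀ p m, quantCoeff c q p m = s * (((if p = i then if m = j then 1 else 0 else 0)
        - (if p = j then if m = i then 1 else 0 else 0))
        - (PowerSeries.X * PowerSeries.C (c i j p m / 2)
          + PowerSeries.X * PowerSeries.C (c i j m p / 2)))) :
    ∑ p, ∑ m, quantCoeff c q p m • (b p * b m) =
      s • (b i * b j - b j * b i - ∑ p, ∑ m,
        (PowerSeries.X * PowerSeries.C (c i j p m / 2)) • (b p * b m + b m * b p)) := by
  simp only [hq, mul_smul s, ← Finset.smul_sum]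
  rw [sum_smul_commutator_sub_symm b (fun p m => PowerSeries.X * PowerSeries.C (c i j p m / 2))]

variable [CharZero k]

theorem quantCoeff_zero (p m : Fin 3) :
    quantCoeff c 0 p m = 1 * (((if p = 1 then if m = 2 then 1 else 0 else 0)
        - (if p = 2 then if m = 1 then 1 else 0 else 0))
        - (PowerSeries.X * PowerSeries.C (c 1 2 p m / 2)
          + PowerSeries.X * PowerSeries.C (c 1 2 m p / 2))) := by
  fin_cases p <;> fin_cases m <;> simp [quantCoeff, symCoeff, -add_halves, -add_self_div_two] <;> ring

theorem quantCoeff_one (p m : Fin 3) :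
    quantCoeff c 1 p m = -1 * (((if p = 0 then if m = 2 then 1 else 0 else 0)
        - (if p = 2 then if m = 0 then 1 else 0 else 0))
        - (PowerSeries.X * PowerSeries.C (c 0 2 p m / 2)
          + PowerSeries.X * PowerSeries.C (c 0 2 m p / 2))) := by
  fin_cases p <;> fin_cases m <;> simp [quantCoeff, symCoeff, -add_halves, -add_self_div_two] <;> ring

theorem quantCoeff_two (p m : Fin 3) :
    quantCoeff c 2 p m = 1 * (((if p = 0 then if m = 1 then 1 else 0 else 0)
        - (if p = 1 then if m = 0 then 1 else 0 else 0))
        - (PowerSeries.X * PowerSeries.C (c 0 1 p m / 2)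
          + PowerSeries.X * PowerSeries.C (c 0 1 m p / 2))) := by
  fin_cases p <;> fin_cases m <;> simp [quantCoeff, symCoeff, -add_halves, -add_self_div_two] <;> ring

theorem quantCoeff_sum_eq_zero_iff {B : Type*} [Ring B] [Algebra (PowerSeries k) B]
    (b : Fin 3 → B) :
    (∀ q, ∑ i, ∑ m, quantCoeff c q i m • (b i * b m) = 0) ↔
      ∀ i j, i < j → b i * b j = b j * b i + ∑ p, ∑ q,
        (PowerSeries.X * PowerSeries.C (c i j p q / 2)) • (b p * b q + b q * b p) := by
  have h₀ := quantCoeff_relator c b 0 1 2 1 (quantCoeff_zero c)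
  have h₁ := quantCoeff_relator c b 1 0 2 (-1) (quantCoeff_one c)
  have h₂ := quantCoeff_relator c b 2 0 1 1 (quantCoeff_two c)
  rw [one_smul] at h₀ h₂
  rw [neg_one_smul] at h₁
  constructor
  · intro h i j hij
    rw [h 0, eq_comm, sub_sub, sub_eq_zero] at h₀
    rw [h 1, eq_comm, neg_eq_zero, sub_sub, sub_eq_zero] at h₁
    rw [h 2, eq_comm, sub_sub, sub_eq_zero] at h₂
    fin_cases i <;> fin_cases j <;> first | exact absurd hij (by decide) | assumption
  · intro h q
    fin_cases q
    · exact h₀.trans (by rw [h 1 2 (by decide)]; abel)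
    · exact h₁.trans (by rw [h 0 2 (by decide)]; abel)
    · exact h₂.trans (by rw [h 0 1 (by decide)]; abel)

theorem quantGen_relation (q : Fin 3) :
    ∑ i, ∑ m, quantCoeff c q i m • (quantGen c i * quantGen c m) = 0 := by
  refine (quantCoeff_sum_eq_zero_iff c (quantGen c)).mpr (fun i j hij => ?_) q
  have := RingQuot.mkAlgHom_rel (PowerSeries k) (QuantRel.rel (c := c) i j hij)
  simpa only [quantGen, map_mul, map_add, map_sum, map_smul] using this

/-- The universal property of the quantized algebra. -/
theorem exists_quantAlg_lift {B : Type*} [Ring B] [Algebra (PowerSeries k) B] (b : Fin 3 → B)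
    (hb : ∀ q, ∑ i, ∑ m, quantCoeff c q i m • (b i * b m) = 0) :
    ∃ F : QuantAlg k c →ₐ[PowerSeries k] B, ∀ i, F (quantGen c i) = b i := by
  refine ⟨RingQuot.liftAlgHom (PowerSeries k) ⟨FreeAlgebra.lift (PowerSeries k) b, ?_⟩, ?_⟩
  · rintro _ _ ⟨i, j, hij⟩
    simpa only [map_mul, map_add, map_sum, map_smul, FreeAlgebra.lift_ι_apply] using
      (quantCoeff_sum_eq_zero_iff c b).mp hb i j hij
  · intro i
    simp [quantGen]

end Presentation

section Twist

theorem qBracket_X_right {k : Type*} [CommRing k] {n : ℕ}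
    (y : Fin n → Fin n → MvPolynomial (Fin n) k) (f : MvPolynomial (Fin n) k) (j : Fin n) :
    qBracket y f (X j) = ∑ i, y i j * pderiv i f := by
  simp [qBracket, pderiv_X, Pi.single_apply]

theorem qBracket_X_X {k : Type*} [CommRing k] {n : ℕ}
    (y : Fin n → Fin n → MvPolynomial (Fin n) k) (i j : Fin n) :
    qBracket y (X i) (X j) = y i j := by
  simp [qBracket_X_right, pderiv_X, Pi.single_apply]

theorem eval_pderiv_quadratic {k : Type*} [CommRing k] {n : ℕ} (d : Fin n → Fin n → k)
    (x : Fin n → k) (i : Fin n) :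
    eval x (pderiv i (∑ p, ∑ q, C (d p q) * (X p * X q))) = ∑ m, (d i m + d m i) * x m := by
  simp only [map_sum, Derivation.leibniz, pderiv_X, pderiv_C, smul_eq_mul, mul_zero, add_zero,
    map_mul, map_add, eval_C, eval_X, mul_add, add_mul, Finset.sum_add_distrib]
  rw [add_comm]
  congr 1
  · rw [Finset.sum_comm]
    simp [Pi.single_apply, apply_ite (eval x)]
  · simp [Pi.single_apply, apply_ite (eval x)]

variable {k : Type*} [Field k] [CharZero k] (c : Fin 3 → Fin 3 → Fin 3 → Fin 3 → k)

theorem curlPairing_symCoeff_eq_zero (y : Fin 3 → Fin 3 → MvPolynomial (Fin 3) k)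
    (hy : ∀ i j, y i j = ∑ p, ∑ q, C (c i j p q) * (X p * X q))
    (hskew : ∀ i j, y j i = - y i j) (hdiag : ∀ i, y i i = 0)
    (hJac : ∀ f g h : MvPolynomial (Fin 3) k,
        qBracket y (qBracket y f g) h + qBracket y (qBracket y g h) f +
          qBracket y (qBracket y h f) g = 0) (x : Fin 3 → k) :
    curlPairing (symCoeff c) x = 0 := by
  have h := congrArg (eval x) (hJac (X 0) (X 1) (X 2))
  rw [qBracket_X_X, qBracket_X_X, qBracket_X_X] at h
  simp only [qBracket_X_right, Fin.sum_univ_three, hdiag, hskew 0 1, hskew 0 2,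
    hskew 1 2, map_add, map_mul, map_neg, zero_mul, map_zero] at h
  simp only [hy, eval_pderiv_quadratic] at h
  simp only [map_sum, map_mul, eval_C, eval_X] at h
  simp only [Fin.sum_univ_three] at h
  simp only [curlPairing, quadCurl, Fin.sum_univ_three, leviCivita_same_left,
    leviCivita_same_right, leviCivita_same_outer, leviCivita_zero_one_two,
    leviCivita_one_two_zero, leviCivita_two_zero_one, leviCivita_zero_two_one,
    leviCivita_two_one_zero, leviCivita_one_zero_two, symCoeff, Matrix.cons_val]
  linear_combination (-1 / 2) * h

theorem exists_quantTwist (hF : ∀ x, curlPairing (symCoeff c) x = 0) :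
    ∃ P Q : Fin 3 → Fin 3 → PowerSeries k,
      (∀ q l, PowerSeries.constantCoeff (P q l) = if q = l then 1 else 0) ∧
      ∀ i m l, ∑ q, P q l * quantCoeff c q i m = ∑ q, Q q i * quantCoeff c q m l := by
  obtain ⟨P₁, P₂, h₁, h₂, h₃⟩ := exists_twist_of_curlPairing (symCoeff c) (symCoeff_symm c) hF
  let d : Fin 3 → Fin 3 → k := fun q l => if q = l then 1 else 0
  have hd : ∀ (f : Fin 3 → k) (l : Fin 3), ∑ q, d q l * f q = f l := fun f l => by simp [d]
  refine ⟨fun q l => PowerSeries.C (d q l) + PowerSeries.X * PowerSeries.C (P₁ q l)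
      + PowerSeries.X ^ 2 * PowerSeries.C (P₂ q l),
    fun q l => PowerSeries.C (d q l) - PowerSeries.X * PowerSeries.C (P₁ q l)
      + PowerSeries.X ^ 2 * PowerSeries.C (P₂ q l), fun q l => by simp [d], fun i m l => ?_⟩
  have e₀ : ∑ q, d q l * leviCivita k q i m = ∑ q, d q i * leviCivita k q m l := by
    rw [hd (fun q => leviCivita k q i m), hd (fun q => leviCivita k q m l), leviCivita_cyclic,
      leviCivita_cyclic]
  have e₁ := h₁ i m l
  rw [← hd (fun q => symCoeff c q i m) l, ← hd (fun q => symCoeff c q m l) i] at e₁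
  have e₂ := h₂ i m l
  have e₃ := h₃ i m l
  replace e₀ := congrArg (PowerSeries.C (R := k)) e₀
  replace e₁ := congrArg (PowerSeries.C (R := k)) e₁
  replace e₂ := congrArg (PowerSeries.C (R := k)) e₂
  replace e₃ := congrArg (PowerSeries.C (R := k)) e₃
  simp only [map_add, map_sub, map_mul, Fin.sum_univ_three] at e₀ e₁ e₂ e₃
  simp only [quantCoeff, Fin.sum_univ_three]
  linear_combination e₀ + PowerSeries.X * e₁ + PowerSeries.X ^ 2 * e₂ - PowerSeries.X ^ 3 * e₃

/-- The relations of the quantized algebra satisfy the twisted cubic identity. -/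
theorem sum_twist_mul_eq_zero (P Q : Fin 3 → Fin 3 → PowerSeries k)
    (hPQ : ∀ i m l, ∑ q, P q l * quantCoeff c q i m = ∑ q, Q q i * quantCoeff c q m l)
    (i : Fin 3) :
    ∑ q, ∑ m, quantCoeff c q i m • (quantGen c m * ∑ l, P q l • quantGen c l) = 0 := by
  calc _ = ∑ m, ∑ l, (∑ q, P q l * quantCoeff c q i m) • (quantGen c m * quantGen c l) := by
        simp only [Finset.mul_sum, Finset.smul_sum, Finset.sum_smul, mul_smul_comm, smul_smul,
          mul_comm (P _ _)]
        rw [Finset.sum_comm]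
        exact Finset.sum_congr rfl fun m _ => Finset.sum_comm
    _ = ∑ q, Q q i • ∑ m, ∑ l, quantCoeff c q m l • (quantGen c m * quantGen c l) := by
        simp only [hPQ, Finset.smul_sum, Finset.sum_smul, smul_smul]
        rw [Finset.sum_comm (γ := Fin 3) (s := Finset.univ) (t := Finset.univ)
          (f := fun q m => ∑ l, (Q q i * quantCoeff c q m l) • (quantGen c m * quantGen c l))]
        exact Finset.sum_congr rfl fun m _ => Finset.sum_comm
    _ = 0 := by simp only [quantGen_relation, smul_zero, Finset.sum_const_zero]

end Twist

section Structure

set_option maxSynthPendingDepth 6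

variable {k : Type*} [Field k] (c : Fin 3 → Fin 3 → Fin 3 → Fin 3 → k)

theorem quantAlg_eq_scalar_add (x : QuantAlg k c) :
    ∃ (s : PowerSeries k) (f : Fin 3 → QuantAlg k c),
      x = algebraMap _ _ s + ∑ i, quantGen c i * f i := by
  induction x using quantAlg_induction with
  | scalar s => exact ⟨s, 0, by simp⟩
  | gen j => exact ⟨0, Pi.single j 1, by simp [Pi.single_apply]⟩
  | add x y hx hy =>
    obtain ⟨s, f, rfl⟩ := hx
    obtain ⟨t, g, rfl⟩ := hy
    refine ⟨s + t, f + g, ?_⟩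
    simp only [map_add, Pi.add_apply, mul_add, Finset.sum_add_distrib]
    abel
  | mul x y hx hy =>
    obtain ⟨s, f, rfl⟩ := hx
    obtain ⟨t, g, hg⟩ := hy
    refine ⟨s * t, fun i => s • g i + f i * y, ?_⟩
    rw [add_mul, Finset.sum_mul, ← Algebra.smul_def]
    nth_rw 1 [hg]
    simp only [smul_add, mul_add, Finset.sum_add_distrib, Finset.smul_sum, mul_smul_comm,
      map_mul, Algebra.smul_def s (algebraMap _ _ t), mul_assoc]
    abel

/-- The map whose image is the module of syzygies of the generators. -/
noncomputable def syzygyMap :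
    (Fin 3 → QuantAlg k c) →ₗ[PowerSeries k] (Fin 3 → QuantAlg k c) :=
  LinearMap.pi fun i => ∑ q, ∑ m, quantCoeff c q i m •
    (LinearMap.mulLeft (PowerSeries k) (quantGen c m) ∘ₗ LinearMap.proj q)

theorem syzygyMap_apply (h : Fin 3 → QuantAlg k c) (i : Fin 3) :
    syzygyMap c h i = ∑ q, ∑ m, quantCoeff c q i m • (quantGen c m * h q) := by
  simp [syzygyMap, LinearMap.sum_apply]

/-- Left multiplication by a generator, extended by recording its coefficient modulo
the syzygies. -/
noncomputable def extendedMulLeft (j : Fin 3) : Module.End (PowerSeries k)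
    (QuantAlg k c × ((Fin 3 → QuantAlg k c) ⧸ LinearMap.range (syzygyMap c))) :=
  (LinearMap.prod (LinearMap.mulLeft (PowerSeries k) (quantGen c j))
    (Submodule.mkQ _ ∘ₗ LinearMap.single (PowerSeries k) (fun _ => QuantAlg k c) j)) ∘ₗ
    LinearMap.fst _ _ _

theorem extendedMulLeft_apply (j : Fin 3)
    (p : QuantAlg k c × ((Fin 3 → QuantAlg k c) ⧸ LinearMap.range (syzygyMap c))) :
    extendedMulLeft c j p =
      (quantGen c j * p.1, Submodule.mkQ (LinearMap.range (syzygyMap c)) (Pi.single j p.1)) := by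
  simp [extendedMulLeft]

variable [CharZero k]

theorem exists_quantAlg_counit :
    ∃ ε : QuantAlg k c →ₐ[PowerSeries k] PowerSeries k, ∀ i, ε (quantGen c i) = 0 :=
  exists_quantAlg_lift c (fun _ => 0) (by simp)

theorem extendedMulLeft_relation (q : Fin 3) :
    ∑ i, ∑ m, quantCoeff c q i m • (extendedMulLeft c i * extendedMulLeft c m) = 0 := by
  refine LinearMap.ext fun p => ?_
  simp only [LinearMap.sum_apply, LinearMap.smul_apply, Module.End.mul_apply,
    extendedMulLeft_apply, LinearMap.zero_apply]
  apply Prod.ext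
  · simp only [Prod.fst_sum, Prod.smul_fst, ← mul_assoc, ← smul_mul_assoc, ← Finset.sum_mul,
      Prod.fst_zero]
    simp only [smul_mul_assoc, quantGen_relation, zero_mul]
  · simp only [Prod.snd_sum, Prod.smul_snd, Prod.snd_zero, ← map_smul, ← map_sum]
    rw [Submodule.mkQ_apply, Submodule.Quotient.mk_eq_zero]
    refine ⟨Pi.single q p.1, funext fun i => ?_⟩
    rw [syzygyMap_apply]
    simp [Finset.sum_apply, Pi.single_apply, smul_ite]

/-- A linear relation among the generators lies in the module of syzygies. -/
theorem exists_syzygy (f : Fin 3 → QuantAlg k c) (hf : ∑ i, quantGen c i * f i = 0) :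
    ∃ h : Fin 3 → QuantAlg k c,
      ∀ i, f i = ∑ q, ∑ m, quantCoeff c q i m • (quantGen c m * h q) := by
  obtain ⟨F, hF⟩ := exists_quantAlg_lift c (extendedMulLeft c) (extendedMulLeft_relation c)
  have hfst : ∀ x p, (F x p).1 = x * p.1 := by
    intro x
    induction x using quantAlg_induction with
    | scalar s => intro p; simp [Algebra.smul_def, Module.algebraMap_end_apply]
    | gen j => intro p; rw [hF, extendedMulLeft_apply]
    | add x y hx hy => intro p; simp [hx, hy, add_mul]
    | mul x y hx hy => intro p; simp [hx, hy, mul_assoc]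
  have h := congrArg (fun x => (F x (1, 0)).2) hf
  simp only [map_sum, map_mul, hF, LinearMap.sum_apply, Module.End.mul_apply,
    extendedMulLeft_apply, hfst, Prod.snd_sum, mul_one, map_zero, LinearMap.zero_apply,
    Prod.snd_zero] at h
  rw [← map_sum, Finset.univ_sum_single, Submodule.mkQ_apply,
    Submodule.Quotient.mk_eq_zero] at h
  obtain ⟨g, rfl⟩ := h
  exact ⟨g, fun i => syzygyMap_apply c g i⟩

/-- The homogeneous components of elements of the quantized algebra. -/
theorem exists_quantAlg_component :
    ∃ γ : ℕ → QuantAlg k c →+ QuantAlg k c, (∀ x, (∀ n, γ n x = 0) → x = 0) ∧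
      (∀ i x, γ 0 (quantGen c i * x) = 0) ∧
      ∀ n i x, γ (n + 1) (quantGen c i * x) = quantGen c i * γ n x := by
  obtain ⟨F, hF⟩ := exists_quantAlg_lift c
    (fun i => (Polynomial.C (quantGen c i) * Polynomial.X : Polynomial (QuantAlg k c))) (by
      intro q
      have h : ∀ i m, quantCoeff c q i m • ((Polynomial.C (quantGen c i) * Polynomial.X) *
          (Polynomial.C (quantGen c m) * Polynomial.X)) =
          Polynomial.C (quantCoeff c q i m • (quantGen c i * quantGen c m)) *
            (Polynomial.X ^ 2 : Polynomial (QuantAlg k c)) := by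
        intro i m
        rw [← Polynomial.smul_C, smul_mul_assoc, mul_assoc, ← mul_assoc Polynomial.X,
          Polynomial.X_mul_C, Polynomial.C_mul, pow_two]
        simp only [mul_assoc]
      simp only [h, ← Finset.sum_mul, ← map_sum, quantGen_relation, map_zero, zero_mul])
  have heval : ∀ x, Polynomial.eval₂RingHom' (RingHom.id (QuantAlg k c)) 1
      (fun _ => Commute.one_right _) (F x) = x := by
    intro x
    induction x using quantAlg_induction with
    | scalar s =>
      rw [AlgHom.commutes, Polynomial.algebraMap_apply]
      simp [Polynomial.eval₂RingHom']
    | gen j => rw [hF, map_mul]; simp [Polynomial.eval₂RingHom']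
    | add x y hx hy => rw [map_add, map_add, hx, hy]
    | mul x y hx hy => rw [map_mul, map_mul, hx, hy]
  refine ⟨fun n => (Polynomial.lcoeff (QuantAlg k c) n).toAddMonoidHom.comp
    F.toRingHom.toAddMonoidHom, fun x hx => ?_, fun i x => ?_, fun n i x => ?_⟩
  · rw [← heval x, show F x = 0 from Polynomial.ext fun n => by simpa using hx n, map_zero]
  · simp [hF, mul_assoc]
  · simp [hF, mul_assoc]

end Structure

section Projection

set_option maxSynthPendingDepth 6

variable {k : Type*} [Field k] (c : Fin 3 → Fin 3 → Fin 3 → Fin 3 → k)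

theorem exists_quantAlg_projection [CharZero k] :
    ∃ π : QuantAlg k c →ₐ[k] MvPolynomial (Fin 3) k, (∀ i, π (quantGen c i) = X i) ∧
      ∀ (s : PowerSeries k) (x : QuantAlg k c),
        π (s • x) = C (PowerSeries.constantCoeff s) * π x := by
  let _ : Algebra (PowerSeries k) (MvPolynomial (Fin 3) k) :=
    ((C : k →+* MvPolynomial (Fin 3) k).comp PowerSeries.constantCoeff).toAlgebra
  have hsmul : ∀ (s : PowerSeries k) (f : MvPolynomial (Fin 3) k),
      s • f = C (PowerSeries.constantCoeff s) * f := fun s f => Algebra.smul_def s f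
  obtain ⟨F, hF⟩ := exists_quantAlg_lift c (X : Fin 3 → MvPolynomial (Fin 3) k) (by
    intro q
    simp only [hsmul]
    fin_cases q <;> simp [quantCoeff, Fin.sum_univ_three] <;> ring)
  refine ⟨{ F.toRingHom with
    commutes' := fun r => ?_ }, hF, fun s x => ?_⟩
  · have h : algebraMap k (QuantAlg k c) r = PowerSeries.C r • (1 : QuantAlg k c) := by
      rw [← Algebra.algebraMap_eq_smul_one]
      rfl
    change F (algebraMap k (QuantAlg k c) r) = _
    rw [h, map_smul, hsmul]
    simp [MvPolynomial.algebraMap_eq]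
  · exact (map_smul F s x).trans (hsmul s _)

theorem quantAlg_projection_surjective (π : QuantAlg k c →ₐ[k] MvPolynomial (Fin 3) k)
    (hπ : ∀ i, π (quantGen c i) = X i) : Function.Surjective π := by
  intro f
  induction f using MvPolynomial.induction_on with
  | C r => exact ⟨algebraMap k _ r, by rw [AlgHom.commutes, MvPolynomial.algebraMap_eq]⟩
  | add f g hf hg =>
    obtain ⟨x, rfl⟩ := hf
    obtain ⟨y, rfl⟩ := hg
    exact ⟨x + y, map_add π x y⟩
  | mul_X f i hf =>
    obtain ⟨x, rfl⟩ := hf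
    exact ⟨x * quantGen c i, by rw [map_mul, hπ]⟩

/-- The standard monomials of the quantized algebra. -/
noncomputable def quantMonomial (e : ℕ × ℕ × ℕ) : QuantAlg k c :=
  quantGen c 0 ^ e.1 * quantGen c 1 ^ e.2.1 * quantGen c 2 ^ e.2.2

theorem linearIndependent_X_pow_mul :
    LinearIndependent k (fun e : ℕ × ℕ × ℕ =>
      (X 0 ^ e.1 * X 1 ^ e.2.1 * X 2 ^ e.2.2 : MvPolynomial (Fin 3) k)) := by
  let g : ℕ × ℕ × ℕ → (Fin 3 →₀ ℕ) := fun e =>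
    Finsupp.single 0 e.1 + Finsupp.single 1 e.2.1 + Finsupp.single 2 e.2.2
  have hg : Function.Injective g := by
    rintro ⟨p, q, r⟩ ⟨p', q', r'⟩ h
    have h₀ := DFunLike.congr_fun h 0
    have h₁ := DFunLike.congr_fun h 1
    have h₂ := DFunLike.congr_fun h 2
    simp [g] at h₀ h₁ h₂
    simp [h₀, h₁, h₂]
  have h : (fun e : ℕ × ℕ × ℕ =>
      (X 0 ^ e.1 * X 1 ^ e.2.1 * X 2 ^ e.2.2 : MvPolynomial (Fin 3) k)) =
      MvPolynomial.basisMonomials (Fin 3) k ∘ g := by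
    funext e
    simp [g, X_pow_eq_monomial, monomial_mul]
  rw [h]
  exact (MvPolynomial.basisMonomials (Fin 3) k).linearIndependent.comp g hg

theorem X_dvd_of_projection_eq_zero (π : QuantAlg k c →ₐ[k] MvPolynomial (Fin 3) k)
    (hπ : ∀ i, π (quantGen c i) = X i)
    (hs : ∀ (s : PowerSeries k) (x : QuantAlg k c),
        π (s • x) = C (PowerSeries.constantCoeff s) * π x)
    (s : ℕ × ℕ × ℕ →₀ PowerSeries k)
    (h : π (Finsupp.linearCombination (PowerSeries k) (quantMonomial c) s) = 0) :
    ∃ t : ℕ × ℕ × ℕ →₀ PowerSeries k, s = (PowerSeries.X : PowerSeries k) • t := by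
  have hdvd : ∀ e, (PowerSeries.X : PowerSeries k) ∣ s e := by
    intro e
    rw [PowerSeries.X_dvd_iff]
    by_contra he
    have := (linearIndependent_iff'.mp (linearIndependent_X_pow_mul (k := k))) s.support
      (fun e => PowerSeries.constantCoeff (s e)) (by
        rw [← h, Finsupp.linearCombination_apply, Finsupp.sum, map_sum]
        refine Finset.sum_congr rfl fun e _ => ?_
        rw [hs, quantMonomial, MvPolynomial.smul_eq_C_mul]
        simp only [map_mul, map_pow, hπ]) e
    exact he (this (Finsupp.mem_support_iff.mpr fun h0 => he (by rw [h0, map_zero])))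
  choose t ht using hdvd
  refine ⟨Finsupp.onFinset s.support t fun e he => ?_, Finsupp.ext fun e => ?_⟩
  · rw [Finsupp.mem_support_iff, ht e]
    exact mul_ne_zero PowerSeries.X_ne_zero he
  · simpa using ht e

end Projection

section Spanning

set_option maxSynthPendingDepth 6

variable {k : Type*} [Field k] (c : Fin 3 → Fin 3 → Fin 3 → Fin 3 → k)

theorem quantGen_commutator_of_lt {i j : Fin 3} (hij : i < j) :
    quantGen c i * quantGen c j - quantGen c j * quantGen c i =
      (PowerSeries.X : PowerSeries k) • ∑ p, ∑ q, PowerSeries.C (c i j p q / 2) •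
        (quantGen c p * quantGen c q + quantGen c q * quantGen c p) := by
  have h := RingQuot.mkAlgHom_rel (PowerSeries k) (QuantRel.rel (c := c) i j hij)
  simp only [map_mul, map_add, map_sum, map_smul] at h
  simp only [quantGen, h, add_sub_cancel_left, Finset.smul_sum, smul_smul]

/-- The span of the generators of the quantized algebra. -/
noncomputable def quantGenSpan : Submodule (PowerSeries k) (QuantAlg k c) :=
  Submodule.span (PowerSeries k) (Set.range (quantGen c))

theorem quantGen_mem_quantGenSpan (i : Fin 3) : quantGen c i ∈ quantGenSpan c :=
  Submodule.subset_span ⟨i, rfl⟩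

theorem quantGen_pow_mem (i : Fin 3) (n : ℕ) : quantGen c i ^ n ∈ quantGenSpan c ^ n :=
  Submodule.pow_mem_pow _ (quantGen_mem_quantGenSpan c i) n

theorem exists_quantGen_commutator (i j : Fin 3) :
    ∃ w ∈ quantGenSpan c ^ 2, quantGen c i * quantGen c j - quantGen c j * quantGen c i =
      (PowerSeries.X : PowerSeries k) • w := by
  have hmem : ∀ i j : Fin 3, ∑ p, ∑ q, PowerSeries.C (c i j p q / 2) •
      (quantGen c p * quantGen c q + quantGen c q * quantGen c p) ∈ quantGenSpan c ^ 2 := by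
    intro i j
    rw [pow_two]
    exact Submodule.sum_mem _ fun p _ => Submodule.sum_mem _ fun q _ => Submodule.smul_mem _ _
      (Submodule.add_mem _
        (Submodule.mul_mem_mul (quantGen_mem_quantGenSpan c p) (quantGen_mem_quantGenSpan c q))
        (Submodule.mul_mem_mul (quantGen_mem_quantGenSpan c q) (quantGen_mem_quantGenSpan c p)))
  rcases lt_trichotomy i j with hij | rfl | hij
  · exact ⟨_, hmem i j, quantGen_commutator_of_lt c hij⟩
  · exact ⟨0, Submodule.zero_mem _, by simp⟩
  · refine ⟨_, Submodule.neg_mem _ (hmem j i), ?_⟩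
    rw [smul_neg, ← quantGen_commutator_of_lt c hij, neg_sub]

theorem exists_commutator_of_mem_span (i : Fin 3) {v : QuantAlg k c} (hv : v ∈ quantGenSpan c) :
    ∃ w ∈ quantGenSpan c ^ 2, quantGen c i * v - v * quantGen c i =
      (PowerSeries.X : PowerSeries k) • w := by
  induction hv using Submodule.span_induction with
  | mem v hv =>
    obtain ⟨j, rfl⟩ := hv
    exact exists_quantGen_commutator c i j
  | zero => exact ⟨0, Submodule.zero_mem _, by simp⟩
  | add v v' _ _ h h' =>
    obtain ⟨w, hw, e⟩ := h
    obtain ⟨w', hw', e'⟩ := h'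
    refine ⟨w + w', Submodule.add_mem _ hw hw', ?_⟩
    rw [smul_add, ← e, ← e']
    noncomm_ring
  | smul s v _ h =>
    obtain ⟨w, hw, e⟩ := h
    refine ⟨s • w, Submodule.smul_mem _ s hw, ?_⟩
    rw [smul_comm, ← e, smul_sub, mul_smul_comm, smul_mul_assoc]

theorem exists_commutator_of_mem_pow (i : Fin 3) {n : ℕ} {x : QuantAlg k c}
    (hx : x ∈ quantGenSpan c ^ n) :
    ∃ w ∈ quantGenSpan c ^ (n + 1), quantGen c i * x - x * quantGen c i =
      (PowerSeries.X : PowerSeries k) • w := by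
  induction hx using Submodule.pow_induction_on_left' with
  | algebraMap r => exact ⟨0, Submodule.zero_mem _, by simp [Algebra.commutes r]⟩
  | add x y n _ _ h h' =>
    obtain ⟨w, hw, e⟩ := h
    obtain ⟨w', hw', e'⟩ := h'
    refine ⟨w + w', Submodule.add_mem _ hw hw', ?_⟩
    rw [smul_add, ← e, ← e']
    noncomm_ring
  | mem_mul v hv n x hx h =>
    obtain ⟨w, hw, e⟩ := h
    obtain ⟨w', hw', e'⟩ := exists_commutator_of_mem_span c i hv
    refine ⟨w' * x + v * w, Submodule.add_mem _ ?_ ?_, ?_⟩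
    · rw [show n.succ + 1 = 2 + n by omega, pow_add]
      exact Submodule.mul_mem_mul hw' hx
    · rw [pow_succ' _ (n + 1)]
      exact Submodule.mul_mem_mul hv hw
    · rw [smul_add, ← smul_mul_assoc, ← mul_smul_comm, ← e, ← e']
      noncomm_ring

theorem quantMonomial_mem_pow (e : ℕ × ℕ × ℕ) :
    quantMonomial c e ∈ quantGenSpan c ^ (e.1 + e.2.1 + e.2.2) := by
  rw [pow_add, pow_add]
  exact Submodule.mul_mem_mul (Submodule.mul_mem_mul (quantGen_pow_mem c 0 _)
    (quantGen_pow_mem c 1 _)) (quantGen_pow_mem c 2 _)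

/-- Left multiplication by a generator sends a standard monomial to a standard monomial up to
a multiple of `ħ`. -/
theorem quantGen_mul_quantMonomial (i : Fin 3) (e : ℕ × ℕ × ℕ) :
    ∃ e' : ℕ × ℕ × ℕ, e'.1 + e'.2.1 + e'.2.2 = e.1 + e.2.1 + e.2.2 + 1 ∧
      ∃ w ∈ quantGenSpan c ^ (e.1 + e.2.1 + e.2.2 + 1),
        quantGen c i * quantMonomial c e =
          quantMonomial c e' + (PowerSeries.X : PowerSeries k) • w := by
  obtain ⟨p, q, r⟩ := e
  simp only [quantMonomial]
  fin_cases i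
  · refine ⟨(p + 1, q, r), by simp only; omega, 0, Submodule.zero_mem _, ?_⟩
    simp [pow_succ', mul_assoc]
  · obtain ⟨w, hw, e⟩ := exists_commutator_of_mem_pow c 1 (quantGen_pow_mem c 0 p)
    refine ⟨(p, q + 1, r), by simp only; omega, w * (quantGen c 1 ^ q * quantGen c 2 ^ r), ?_, ?_⟩
    · rw [show p + q + r + 1 = (p + 1) + (q + r) by omega, pow_add, pow_add _ q]
      exact Submodule.mul_mem_mul hw (Submodule.mul_mem_mul (quantGen_pow_mem c 1 q)
        (quantGen_pow_mem c 2 r))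
    · rw [← smul_mul_assoc, ← e]
      simp only [pow_succ', sub_mul, mul_assoc, add_sub_cancel, Fin.mk_one]
  · obtain ⟨w, hw, e⟩ := exists_commutator_of_mem_pow c 2 (x := quantGen c 0 ^ p * quantGen c 1 ^ q)
      (n := p + q) (by
        rw [pow_add]
        exact Submodule.mul_mem_mul (quantGen_pow_mem c 0 p) (quantGen_pow_mem c 1 q))
    refine ⟨(p, q, r + 1), by simp only; omega, w * quantGen c 2 ^ r, ?_, ?_⟩
    · rw [show p + q + r + 1 = (p + q + 1) + r by omega, pow_add]
      exact Submodule.mul_mem_mul hw (quantGen_pow_mem c 2 r)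
    · rw [← smul_mul_assoc, ← e]
      simp only [pow_succ', sub_mul, mul_assoc, add_sub_cancel, Fin.reduceFinMk]

theorem quantGenSpan_pow_le (n : ℕ) :
    quantGenSpan c ^ n ≤ Submodule.span (PowerSeries k)
      (quantMonomial c '' {e | e.1 + e.2.1 + e.2.2 = n}) := by
  induction n with
  | zero =>
    rw [pow_zero, Submodule.one_le]
    exact Submodule.subset_span ⟨(0, 0, 0), by simp, by simp [quantMonomial]⟩
  | succ n ih =>
    have hfg : (quantGenSpan c ^ (n + 1)).FG :=
      Submodule.FG.pow (Submodule.fg_span (Set.finite_range _)) _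
    refine Submodule.le_of_le_smul_of_le_jacobson_bot (I := Ideal.span {PowerSeries.X}) hfg ?_ ?_
    · rw [IsLocalRing.jacobson_eq_maximalIdeal _ bot_ne_top,
        PowerSeries.maximalIdeal_eq_span_X]
    · rw [pow_succ']
      refine (mul_le_mul_right ih _).trans ?_
      rw [← pow_succ', quantGenSpan, Submodule.span_mul_span, Submodule.span_le]
      rintro _ ⟨_, ⟨i, rfl⟩, _, ⟨e, rfl, rfl⟩, rfl⟩
      obtain ⟨e', he', w, hw, h⟩ := quantGen_mul_quantMonomial c i e
      change quantGen c i * quantMonomial c e ∈ _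
      rw [h]
      exact Submodule.add_mem_sup (Submodule.subset_span ⟨e', he', rfl⟩)
        (Submodule.smul_mem_smul (Ideal.subset_span rfl) hw)

theorem span_quantMonomial :
    Submodule.span (PowerSeries k) (Set.range (quantMonomial c)) = ⊤ := by
  set T := Submodule.span (PowerSeries k) (Set.range (quantMonomial c)) with hT
  have hgen : ∀ i, ∀ t ∈ T, quantGen c i * t ∈ T := by
    intro i t ht
    induction ht using Submodule.span_induction with
    | mem t ht =>
      obtain ⟨e, rfl⟩ := ht
      have h : quantGen c i * quantMonomial c e ∈ quantGenSpan c ^ (e.1 + e.2.1 + e.2.2 + 1) := by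
        rw [pow_succ']
        exact Submodule.mul_mem_mul (quantGen_mem_quantGenSpan c i) (quantMonomial_mem_pow c e)
      exact Submodule.span_mono (Set.image_subset_range _ _) (quantGenSpan_pow_le c _ h)
    | zero => simp
    | add x y _ _ hx hy => rw [mul_add]; exact Submodule.add_mem _ hx hy
    | smul s x _ hx => rw [mul_smul_comm]; exact Submodule.smul_mem _ _ hx
  have hall : ∀ x : QuantAlg k c, ∀ t ∈ T, x * t ∈ T := by
    intro x
    induction x using quantAlg_induction with
    | scalar s => intro t ht; rw [← Algebra.smul_def]; exact Submodule.smul_mem _ _ ht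
    | gen i => exact hgen i
    | add x y hx hy => intro t ht; rw [add_mul]; exact Submodule.add_mem _ (hx t ht) (hy t ht)
    | mul x y hx hy => intro t ht; rw [mul_assoc]; exact hx _ (hy t ht)
  refine eq_top_iff.mpr fun x _ => ?_
  have h := hall x 1 (Submodule.subset_span ⟨(0, 0, 0), by simp [quantMonomial]⟩)
  rwa [mul_one] at h

theorem exists_eq_X_smul_of_projection_eq_zero (π : QuantAlg k c →ₐ[k] MvPolynomial (Fin 3) k)
    (hπ : ∀ i, π (quantGen c i) = X i)
    (hs : ∀ (s : PowerSeries k) (x : QuantAlg k c),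
        π (s • x) = C (PowerSeries.constantCoeff s) * π x)
    (x : QuantAlg k c) (hx : π x = 0) : ∃ u, x = (PowerSeries.X : PowerSeries k) • u := by
  have h : x ∈ Submodule.span (PowerSeries k) (Set.range (quantMonomial c)) := by
    rw [span_quantMonomial]
    trivial
  obtain ⟨s, rfl⟩ := (Finsupp.mem_span_range_iff_exists_finsupp).mp h
  rw [← Finsupp.linearCombination_apply] at hx ⊢
  obtain ⟨t, rfl⟩ := X_dvd_of_projection_eq_zero c π hπ hs s hx
  exact ⟨_, map_smul _ _ _⟩

end Spanning

section Flatness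

set_option maxSynthPendingDepth 6

/-- The Koszul complex on three variables is exact in the middle. -/
theorem exists_eq_X_mul_of_cross_eq_zero {k : Type*} [Field k]
    (H : Fin 3 → MvPolynomial (Fin 3) k) (h₁ : X 1 * H 0 = X 0 * H 1)
    (h₂ : X 2 * H 0 = X 0 * H 2) : ∃ t, ∀ q, H q = X q * t := by
  have hdvd : (X 0 : MvPolynomial (Fin 3) k) ∣ X 1 * H 0 := ⟨H 1, h₁⟩
  obtain ⟨t, ht⟩ : (X 0 : MvPolynomial (Fin 3) k) ∣ H 0 := by
    refine (MvPolynomial.X_prime.dvd_or_dvd hdvd).resolve_left fun h => ?_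
    rw [MvPolynomial.X_dvd_X] at h
    exact absurd h (by decide)
  have hX : (X 0 : MvPolynomial (Fin 3) k) ≠ 0 := MvPolynomial.X_ne_zero 0
  refine ⟨t, fun q => ?_⟩
  fin_cases q
  · exact ht
  · change H 1 = X 1 * t
    exact mul_left_cancel₀ hX (by rw [← h₁, ht]; ring)
  · change H 2 = X 2 * t
    exact mul_left_cancel₀ hX (by rw [← h₂, ht]; ring)

variable {k : Type*} [Field k] [CharZero k] (c : Fin 3 → Fin 3 → Fin 3 → Fin 3 → k)

theorem exists_eq_sum_of_X_smul_eq_zero (hF : ∀ x, curlPairing (symCoeff c) x = 0)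
    (x : QuantAlg k c) (hx : (PowerSeries.X : PowerSeries k) • x = 0) :
    ∃ u : Fin 3 → QuantAlg k c, (∀ i, (PowerSeries.X : PowerSeries k) • u i = 0) ∧
      x = ∑ i, quantGen c i * u i := by
  obtain ⟨π, hπ, hs⟩ := exists_quantAlg_projection c
  obtain ⟨P, Q, hP, hPQ⟩ := exists_quantTwist c hF
  obtain ⟨s, f, rfl⟩ := quantAlg_eq_scalar_add c x
  have hs0 : s = 0 := by
    obtain ⟨ε, hε⟩ := exists_quantAlg_counit c
    have h := congrArg ε hx
    simp only [map_smul, map_add, map_sum, map_mul, hε, zero_mul, Finset.sum_const_zero,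
      add_zero, AlgHom.commutes, map_zero, Algebra.algebraMap_self, RingHom.id_apply,
      smul_eq_mul] at h
    exact (mul_eq_zero.mp h).resolve_left PowerSeries.X_ne_zero
  subst hs0
  rw [map_zero, zero_add] at hx ⊢
  obtain ⟨h, hh⟩ := exists_syzygy c (fun i => (PowerSeries.X : PowerSeries k) • f i) (by
    simpa only [mul_smul_comm, ← Finset.smul_sum] using hx)
  have hcross : ∀ i, ∑ q, ∑ m, C (leviCivita k q i m) * (X m * π (h q)) = 0 := by
    intro i
    have := congrArg π (hh i)
    simp only [hs, map_sum, map_mul, hπ, PowerSeries.constantCoeff_X, map_zero, zero_mul] at this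
    simpa [quantCoeff] using this.symm
  obtain ⟨t, ht⟩ := exists_eq_X_mul_of_cross_eq_zero (fun q => π (h q))
    (by have := hcross 2; simp [Fin.sum_univ_three] at this; linear_combination -this)
    (by have := hcross 1; simp [Fin.sum_univ_three] at this; linear_combination this)
  obtain ⟨τ, rfl⟩ := quantAlg_projection_surjective c π hπ t
  have hdecomp : ∀ q, ∃ u, h q - (∑ l, P q l • quantGen c l) * τ =
      (PowerSeries.X : PowerSeries k) • u := by
    intro q
    refine exists_eq_X_smul_of_projection_eq_zero c π hπ hs _ ?_
    have := ht q
    simp only [map_sub, map_mul, map_sum, hs, hP, hπ] at this ⊢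
    simp [this]
  choose h' hh' using hdecomp
  refine ⟨fun i => f i - ∑ q, ∑ m, quantCoeff c q i m • (quantGen c m * h' q), fun i => ?_, ?_⟩
  · rw [smul_sub, hh i]
    simp only [Finset.smul_sum, smul_comm (PowerSeries.X : PowerSeries k), ← mul_smul_comm, ← hh']
    simp only [← Finset.sum_sub_distrib, ← smul_sub, ← mul_sub, sub_sub_cancel]
    have := congrArg (· * τ) (sum_twist_mul_eq_zero c P Q hPQ i)
    simpa only [Finset.sum_mul, smul_mul_assoc, mul_assoc, zero_mul, mul_smul_comm] using this
  · have hz : ∑ i, quantGen c i * ∑ q, ∑ m, quantCoeff c q i m • (quantGen c m * h' q) = 0 := by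
      have : ∀ q, ∑ i, ∑ m, quantCoeff c q i m • (quantGen c i * (quantGen c m * h' q)) = 0 := by
        intro q
        have := congrArg (· * h' q) (quantGen_relation c q)
        simpa only [Finset.sum_mul, smul_mul_assoc, mul_assoc, zero_mul] using this
      simp only [Finset.mul_sum, mul_smul_comm]
      rw [Finset.sum_comm]
      simp only [this, Finset.sum_const_zero]
    simp only [mul_sub, Finset.sum_sub_distrib, hz, sub_zero]

theorem eq_zero_of_X_smul_eq_zero (hF : ∀ x, curlPairing (symCoeff c) x = 0)
    (x : QuantAlg k c) (hx : (PowerSeries.X : PowerSeries k) • x = 0) : x = 0 := by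
  obtain ⟨γ, h, h₀, hsucc⟩ := exists_quantAlg_component c
  refine h x fun n => ?_
  induction n generalizing x with
  | zero =>
    obtain ⟨u, -, rfl⟩ := exists_eq_sum_of_X_smul_eq_zero c hF x hx
    simp only [map_sum, h₀, Finset.sum_const_zero]
  | succ n ih =>
    obtain ⟨u, hu, rfl⟩ := exists_eq_sum_of_X_smul_eq_zero c hF x hx
    simp only [map_sum, hsucc, ih _ (hu _), mul_zero, Finset.sum_const_zero]

theorem eq_of_X_smul_eq (hF : ∀ x, curlPairing (symCoeff c) x = 0) {w w' : QuantAlg k c}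
    (h : (PowerSeries.X : PowerSeries k) • w = (PowerSeries.X : PowerSeries k) • w') : w = w' :=
  sub_eq_zero.mp (eq_zero_of_X_smul_eq_zero c hF (w - w') (by rw [smul_sub, h, sub_self]))

theorem linearIndependent_quantMonomial (hF : ∀ x, curlPairing (symCoeff c) x = 0) :
    LinearIndependent (PowerSeries k) (quantMonomial c) := by
  obtain ⟨π, hπ, hs⟩ := exists_quantAlg_projection c
  have hdvd : ∀ (n : ℕ) (s : ℕ × ℕ × ℕ →₀ PowerSeries k),
      Finsupp.linearCombination (PowerSeries k) (quantMonomial c) s = 0 →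
        ∀ e, PowerSeries.X ^ n ∣ s e := by
    intro n
    induction n with
    | zero => intro s _ e; simp
    | succ n ih =>
      intro s hs0 e
      obtain ⟨t, rfl⟩ := X_dvd_of_projection_eq_zero c π hπ hs s (by rw [hs0, map_zero])
      rw [map_smul] at hs0
      rw [pow_succ', Finsupp.smul_apply, smul_eq_mul]
      exact mul_dvd_mul_left _ (ih t (eq_zero_of_X_smul_eq_zero c hF _ hs0) e)
  rw [linearIndependent_iff]
  intro s hs0
  ext e n
  exact (PowerSeries.X_pow_dvd_iff.mp (hdvd (n + 1) s hs0 e)) n n.lt_succ_self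

end Flatness

section Bracket

set_option maxSynthPendingDepth 6

variable {k : Type*}

theorem qBracket_C_left [CommRing k] {n : ℕ} (y : Fin n → Fin n → MvPolynomial (Fin n) k)
    (r : k) (g : MvPolynomial (Fin n) k) : qBracket y (C r) g = 0 := by
  simp [qBracket]

theorem qBracket_C_right [CommRing k] {n : ℕ} (y : Fin n → Fin n → MvPolynomial (Fin n) k)
    (f : MvPolynomial (Fin n) k) (r : k) : qBracket y f (C r) = 0 := by
  simp [qBracket]

theorem qBracket_add_left [CommRing k] {n : ℕ} (y : Fin n → Fin n → MvPolynomial (Fin n) k)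
    (f f' g : MvPolynomial (Fin n) k) :
    qBracket y (f + f') g = qBracket y f g + qBracket y f' g := by
  simp only [qBracket, map_add, mul_add, add_mul, Finset.sum_add_distrib]

theorem qBracket_add_right [CommRing k] {n : ℕ} (y : Fin n → Fin n → MvPolynomial (Fin n) k)
    (f g g' : MvPolynomial (Fin n) k) :
    qBracket y f (g + g') = qBracket y f g + qBracket y f g' := by
  simp only [qBracket, map_add, mul_add, Finset.sum_add_distrib]

theorem qBracket_mul_left [CommRing k] {n : ℕ} (y : Fin n → Fin n → MvPolynomial (Fin n) k)
    (f f' g : MvPolynomial (Fin n) k) :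
    qBracket y (f * f') g = f * qBracket y f' g + qBracket y f g * f' := by
  simp only [qBracket, Derivation.leibniz, smul_eq_mul, Finset.mul_sum, Finset.sum_mul,
    ← Finset.sum_add_distrib]
  exact Finset.sum_congr rfl fun i _ => Finset.sum_congr rfl fun j _ => by ring

theorem qBracket_mul_right [CommRing k] {n : ℕ} (y : Fin n → Fin n → MvPolynomial (Fin n) k)
    (f g g' : MvPolynomial (Fin n) k) :
    qBracket y f (g * g') = g * qBracket y f g' + qBracket y f g * g' := by
  simp only [qBracket, Derivation.leibniz, smul_eq_mul, Finset.mul_sum, Finset.sum_mul,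
    ← Finset.sum_add_distrib]
  exact Finset.sum_congr rfl fun i _ => Finset.sum_congr rfl fun j _ => by ring

variable [Field k] [CharZero k] (c : Fin 3 → Fin 3 → Fin 3 → Fin 3 → k)

/-- The commutator of two elements is `ħ` times a lift of the bracket of their projections. -/
theorem exists_commutator_eq_X_smul (y : Fin 3 → Fin 3 → MvPolynomial (Fin 3) k)
    (hy : ∀ i j, y i j = ∑ p, ∑ q, C (c i j p q) * (X p * X q))
    (hskew : ∀ i j, y j i = - y i j) (hdiag : ∀ i, y i i = 0)
    (π : QuantAlg k c →ₐ[k] MvPolynomial (Fin 3) k) (hπ : ∀ i, π (quantGen c i) = X i)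
    (hs : ∀ (s : PowerSeries k) (x : QuantAlg k c),
        π (s • x) = C (PowerSeries.constantCoeff s) * π x) (u v : QuantAlg k c) :
    ∃ w, u * v - v * u = (PowerSeries.X : PowerSeries k) • w ∧
      π w = qBracket y (π u) (π v) := by
  have hscalar : ∀ s : PowerSeries k,
      π (algebraMap _ (QuantAlg k c) s) = C (PowerSeries.constantCoeff s) := by
    intro s
    rw [Algebra.algebraMap_eq_smul_one, hs, map_one, mul_one]
  have hlt : ∀ i j, i < j → π (∑ p, ∑ q, PowerSeries.C (c i j p q / 2) •
      (quantGen c p * quantGen c q + quantGen c q * quantGen c p)) = y i j := by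
    intro i j _
    simp only [map_sum, hs, PowerSeries.constantCoeff_C, map_add, map_mul, hπ, hy]
    refine Finset.sum_congr rfl fun p _ => Finset.sum_congr rfl fun q _ => ?_
    rw [mul_comm (X q) (X p), ← two_mul, ← mul_assoc, show (2 : MvPolynomial (Fin 3) k) = C 2 from
      (map_ofNat C 2).symm, ← map_mul, div_mul_cancel₀ _ two_ne_zero]
  have hgen : ∀ i j, ∃ w, quantGen c i * quantGen c j - quantGen c j * quantGen c i =
      (PowerSeries.X : PowerSeries k) • w ∧ π w = y i j := by
    intro i j
    rcases lt_trichotomy i j with hij | rfl | hij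
    · exact ⟨_, quantGen_commutator_of_lt c hij, hlt i j hij⟩
    · exact ⟨0, by simp, by rw [hdiag, map_zero]⟩
    · refine ⟨-_, ?_, (map_neg π _).trans ((congrArg Neg.neg (hlt j i hij)).trans
        (hskew j i).symm)⟩
      rw [smul_neg, ← quantGen_commutator_of_lt c hij, neg_sub]
  have hleft : ∀ i, ∃ w, quantGen c i * v - v * quantGen c i =
      (PowerSeries.X : PowerSeries k) • w ∧ π w = qBracket y (X i) (π v) := by
    intro i
    induction v using quantAlg_induction with
    | scalar s =>
      exact ⟨0, by rw [Algebra.commutes s, sub_self, smul_zero], by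
        rw [hscalar, qBracket_C_right, map_zero]⟩
    | gen j =>
      obtain ⟨w, hw, hw'⟩ := hgen i j
      exact ⟨w, hw, by rw [hw', hπ, qBracket_X_X]⟩
    | add v v' h h' =>
      obtain ⟨w, e, hw⟩ := h
      obtain ⟨w', e', hw'⟩ := h'
      refine ⟨w + w', ?_, by rw [map_add, map_add, hw, hw', qBracket_add_right]⟩
      rw [smul_add, ← e, ← e']
      noncomm_ring
    | mul v v' h h' =>
      obtain ⟨w, e, hw⟩ := h
      obtain ⟨w', e', hw'⟩ := h'
      refine ⟨v * w' + w * v', ?_, by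
        rw [map_add, map_mul, map_mul, map_mul, hw, hw', qBracket_mul_right]⟩
      rw [smul_add, ← mul_smul_comm, ← smul_mul_assoc, ← e, ← e']
      noncomm_ring
  induction u using quantAlg_induction with
  | scalar s =>
    exact ⟨0, by rw [Algebra.commutes s, sub_self, smul_zero], by
      rw [hscalar, qBracket_C_left, map_zero]⟩
  | gen i => rw [hπ]; exact hleft i
  | add u u' h h' =>
    obtain ⟨w, e, hw⟩ := h
    obtain ⟨w', e', hw'⟩ := h'
    refine ⟨w + w', ?_, by rw [map_add, map_add, hw, hw', qBracket_add_left]⟩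
    rw [smul_add, ← e, ← e']
    noncomm_ring
  | mul u u' h h' =>
    obtain ⟨w, e, hw⟩ := h
    obtain ⟨w', e', hw'⟩ := h'
    refine ⟨u * w' + w * u', ?_, by
      rw [map_add, map_mul, map_mul, map_mul, hw, hw', qBracket_mul_left]⟩
    rw [smul_add, ← mul_smul_comm, ← smul_mul_assoc, ← e, ← e']
    noncomm_ring

end Bracket

/-- Theorem 4.1: for any quadratic Poisson bracket `b` on `k[x₁,x₂,x₃]` with
`b(xᵢ,xⱼ) = ∑ c i j p q x_p x_q`, the algebra `R_b` is a PBW (flat) deformation of the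
polynomial algebra realizing `b`: the standard monomials form a `k[[ħ]]`-basis, the quotient
of `R_b` modulo `ħ` is the polynomial algebra, and the bracket induced by `(uv-vu)/ħ`
reduces to `b` modulo `ħ`. -/
theorem quantization_of_quadratic_poisson {k : Type*} [Field k] [CharZero k] [IsAlgClosed k]
    (c : Fin 3 → Fin 3 → Fin 3 → Fin 3 → k)
    (y : Fin 3 → Fin 3 → MvPolynomial (Fin 3) k)
    (hy : ∀ i j, y i j = ∑ p, ∑ q, C (c i j p q) * (X p * X q))
    (hskew : ∀ i j, y j i = - y i j) (hdiag : ∀ i, y i i = 0)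
    (hJac : ∀ f g h : MvPolynomial (Fin 3) k,
        qBracket y (qBracket y f g) h + qBracket y (qBracket y g h) f +
          qBracket y (qBracket y h f) g = 0) :
    (LinearIndependent (PowerSeries k)
        (fun e : ℕ × ℕ × ℕ =>
          (RingQuot.mkAlgHom (PowerSeries k) (QuantRel c)
              (FreeAlgebra.ι (PowerSeries k) 0)) ^ e.1 *
            (RingQuot.mkAlgHom (PowerSeries k) (QuantRel c)
              (FreeAlgebra.ι (PowerSeries k) 1)) ^ e.2.1 *
              (RingQuot.mkAlgHom (PowerSeries k) (QuantRel c)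
                (FreeAlgebra.ι (PowerSeries k) 2)) ^ e.2.2) ∧
      Submodule.span (PowerSeries k)
          (Set.range fun e : ℕ × ℕ × ℕ =>
            (RingQuot.mkAlgHom (PowerSeries k) (QuantRel c)
                (FreeAlgebra.ι (PowerSeries k) 0)) ^ e.1 *
              (RingQuot.mkAlgHom (PowerSeries k) (QuantRel c)
                (FreeAlgebra.ι (PowerSeries k) 1)) ^ e.2.1 *
                (RingQuot.mkAlgHom (PowerSeries k) (QuantRel c)
                  (FreeAlgebra.ι (PowerSeries k) 2)) ^ e.2.2) = ⊤) ∧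
    ∃ π : QuantAlg k c →ₐ[k] MvPolynomial (Fin 3) k,
      (∀ i : Fin 3, π (RingQuot.mkAlgHom (PowerSeries k) (QuantRel c)
          (FreeAlgebra.ι (PowerSeries k) i)) = X i) ∧
      Function.Surjective π ∧
      (∀ x : QuantAlg k c, π x = 0 ↔ ∃ u : QuantAlg k c,
        x = (PowerSeries.X : PowerSeries k) • u) ∧
      (∀ u v w : QuantAlg k c, u * v - v * u = (PowerSeries.X : PowerSeries k) • w →
        π w = qBracket y (π u) (π v)) := by
  have hF := curlPairing_symCoeff_eq_zero c y hy hskew hdiag hJac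
  obtain ⟨π, hπ, hs⟩ := exists_quantAlg_projection c
  refine ⟨⟨linearIndependent_quantMonomial c hF, span_quantMonomial c⟩, π, hπ,
    quantAlg_projection_surjective c π hπ, fun x => ⟨?_, ?_⟩, fun u v w h => ?_⟩
  · exact exists_eq_X_smul_of_projection_eq_zero c π hπ hs x
  · rintro ⟨u, rfl⟩
    rw [hs, PowerSeries.constantCoeff_X, map_zero, zero_mul]
  · obtain ⟨w', hw', hπw⟩ := exists_commutator_eq_X_smul c y hy hskew hdiag π hπ hs u v
    rw [← hπw, eq_of_X_smul_eq c hF (h.symm.trans hw')]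
end

section
/- Let k be a field of characteristic zero, h ∈ k a nonzero scalar, and S = k[z,u₁,u₂] the polynomial ring. In the k-algebra End_k(S) of k-linear endomorphisms of S, let X₁ = ∂/∂u₁ and X₂ = ∂/∂u₂ (the partial derivative operators), let M_g denote multiplication by g ∈ S, and for any two polynomials w₂₃, w₃₁ ∈ k[T₁,T₂] set X₃ = h·(M_{u₂}∘w₂₃(X₁,X₂) − M_{u₁}∘w₃₁(X₁,X₂)) + M_z. Then: (i) [X₁,X₂] = 0, [X₂,X₃] = h·w₂₃(X₁,X₂), and [X₃,X₁] = h·w₃₁(X₁,X₂); and (ii) the standard monomials X₁^{a} X₂^{b} X₃^{c} (a,b,c ≥ 0) are linearly independent over k. -/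
open MvPolynomial

/-- Evaluation `w(D₁,D₂)` of a commutative polynomial in two variables on a pair of
(commuting) linear endomorphisms. -/
noncomputable def evalOps {k : Type*} [Field k] (w : MvPolynomial (Fin 2) k)
    (D₁ D₂ : Module.End k (MvPolynomial (Fin 3) k)) :
    Module.End k (MvPolynomial (Fin 3) k) :=
  (AddMonoidAlgebra.coeff w).sum fun d c => c • (D₁ ^ d 0 * D₂ ^ d 1)

/-- If `d` commutes with all coefficients `P c` and `[d, x] = 1`, a polynomial in `x` with left
coefficients `P c` vanishes only if all its coefficients do. -/
theorem eq_zero_of_sum_mul_pow_eq_zero {k A : Type*} [Field k] [CharZero k] [Ring A] [Algebra k A]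
    {d x : A} (hdx : d * x - x * d = 1) (N : ℕ) (P : ℕ → A) (hP : ∀ c, Commute d (P c))
    (hsum : ∑ c ∈ Finset.range N, P c * x ^ c = 0) : ∀ c < N, P c = 0 := by
  have hpow (c : ℕ) : d * x ^ c - x ^ c * d = (c : k) • x ^ (c - 1) := by
    induction c with
    | zero => simp
    | succ c ih =>
      have hsplit : d * x ^ (c + 1) - x ^ (c + 1) * d =
          (d * x ^ c - x ^ c * d) * x + x ^ c * (d * x - x * d) := by
        rw [pow_succ]; noncomm_ring
      rw [hsplit, ih, hdx]
      rcases c with _ | c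
      · simp
      · simp only [Nat.add_sub_cancel, smul_mul_assoc, mul_one, Nat.cast_succ (c + 1), add_smul,
          one_smul, ← pow_succ]
  induction N generalizing P with
  | zero => simp
  | succ N ih =>
    have hterm (c : ℕ) : d * (P c * x ^ c) - P c * x ^ c * d = (c : k) • (P c * x ^ (c - 1)) := by
      rw [← mul_assoc, (hP c).eq, mul_assoc, mul_assoc, ← mul_sub, hpow, mul_smul_comm]
    have hcomm : ∑ c ∈ Finset.range (N + 1), (c : k) • (P c * x ^ (c - 1)) = 0 := by
      rw [← Finset.sum_congr rfl fun c _ => hterm c, Finset.sum_sub_distrib, ← Finset.mul_sum,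
        ← Finset.sum_mul, hsum]
      simp
    have hsucc : ∀ c < N, P (c + 1) = 0 := by
      intro c hc
      have := ih (fun c => ((c + 1 : ℕ) : k) • P (c + 1)) (fun c => (hP _).smul_right _)
        (by simpa [Finset.sum_range_succ'] using hcomm) c hc
      exact (smul_eq_zero.mp this).resolve_left (Nat.cast_ne_zero.mpr c.succ_ne_zero)
    intro c hc
    rcases c with _ | c
    · rw [Finset.sum_range_succ', Finset.sum_eq_zero] at hsum
      · simpa using hsum
      · intro c hc
        rw [hsucc c (Finset.mem_range.mp hc), zero_mul]
    · exact hsucc c (by omega)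

/-- If `d` commutes with a linearly independent family `v` and `[d, x] = 1`, then the products
`v i * x ^ n` are linearly independent. -/
theorem LinearIndependent.mul_pow_of_commutator_eq_one {k A ι : Type*} [Field k] [CharZero k]
    [Ring A] [Algebra k A] {v : ι → A} (hv : LinearIndependent k v) {d x : A}
    (hd : ∀ i, Commute d (v i)) (hdx : d * x - x * d = 1) :
    LinearIndependent k fun p : ι × ℕ => v p.1 * x ^ p.2 := by
  classical
  rw [linearIndependent_iff'']
  rintro s g hg hsum ⟨i, n⟩
  by_cases hin : (i, n) ∈ s
  swap
  · exact hg _ hin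
  let t := s.image Prod.fst
  obtain ⟨N, hN⟩ := (s.image Prod.snd).exists_nat_subset_range
  have hst : s ⊆ t ×ˢ Finset.range N := fun p hp => Finset.mem_product.mpr
    ⟨Finset.mem_image_of_mem _ hp, hN (Finset.mem_image_of_mem _ hp)⟩
  rw [Finset.sum_subset hst fun p _ hp => by rw [hg p hp, zero_smul],
    Finset.sum_product_right] at hsum
  have hcoeff := eq_zero_of_sum_mul_pow_eq_zero (k := k) hdx N (fun c => ∑ j ∈ t, g (j, c) • v j)
    (fun c => Commute.sum_right _ _ _ fun j _ => (hd j).smul_right _)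
    (by simpa [Finset.sum_mul] using hsum)
    n (Finset.mem_range.mp (Finset.mem_product.mp (hst hin)).2)
  exact linearIndependent_iff'.mp hv t (fun j => g (j, n)) hcoeff i
    (Finset.mem_image_of_mem _ hin)

/-- Partial derivatives commute as linear endomorphisms. -/
theorem MvPolynomial.commute_pderiv {k σ : Type*} [CommRing k] (i j : σ) :
    Commute (S := Module.End k (MvPolynomial σ k)) (pderiv i).toLinearMap
      (pderiv j).toLinearMap := by
  classical
  have hlie : ⁅(pderiv i : Derivation k (MvPolynomial σ k) (MvPolynomial σ k)), pderiv j⁆ = 0 :=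
    derivation_ext fun l => by
      rw [Derivation.commutator_apply, pderiv_X, pderiv_X, Pi.single_apply, Pi.single_apply]
      split_ifs <;> simp
  refine LinearMap.ext fun f => ?_
  have hf : pderiv i (pderiv j f) - pderiv j (pderiv i f) = 0 := by
    rw [← Derivation.commutator_apply, hlie, Derivation.zero_apply]
  exact sub_eq_zero.mp hf

/-- The commutator of a derivation with multiplication by `g` is multiplication by its value at
`g`. -/
theorem Derivation.toLinearMap_mul_mulLeft_sub {k A : Type*} [CommRing k] [CommRing A] [Algebra k A]
    (D : Derivation k A A) (g : A) :
    (D.toLinearMap : Module.End k A) * LinearMap.mulLeft k g -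
      LinearMap.mulLeft k g * (D.toLinearMap : Module.End k A) = LinearMap.mulLeft k (D g) := by
  ext f
  simp [mul_comm]

theorem Commute.evalOps_right {k : Type*} [Field k] {w : MvPolynomial (Fin 2) k}
    {D D₁ D₂ : Module.End k (MvPolynomial (Fin 3) k)} (h₁ : Commute D D₁) (h₂ : Commute D D₂) :
    Commute D (evalOps w D₁ D₂) :=
  Commute.sum_right _ _ _ fun d _ =>
    ((h₁.pow_right (d 0)).mul_right (h₂.pow_right (d 1))).smul_right _

theorem neg_mul_sub_mul_neg {A : Type*} [Ring A] (a b : A) :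
    -a * b - b * -a = b * a - a * b := by
  noncomm_ring

theorem commutator_smul_mul_sub_mul_add {k A : Type*} [CommRing k] [Ring A] [Algebra k A] (h : k)
    {E P Q : A} (hP : Commute E P) (hQ : Commute E Q) (a b c : A) :
    E * (h • (a * P - b * Q) + c) - (h • (a * P - b * Q) + c) * E =
      h • ((E * a - a * E) * P - (E * b - b * E) * Q) + (E * c - c * E) := by
  have key : (E * a - a * E) * P - (E * b - b * E) * Q =
      E * (a * P - b * Q) - (a * P - b * Q) * E := by
    simp only [sub_mul, mul_sub, mul_assoc, hP.eq, hQ.eq]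
    abel
  rw [key, mul_add, add_mul, mul_smul_comm, smul_mul_assoc, smul_sub]
  abel

/-- The realization of the derivation-type quantizations inside `End_k(k[z,u₁,u₂])`:
with `X₁ = ∂/∂u₁`, `X₂ = ∂/∂u₂` and
`X₃ = h (M_{u₂} ∘ w₂₃(X₁,X₂) - M_{u₁} ∘ w₃₁(X₁,X₂)) + M_z`, the commutation relations
`[X₁,X₂] = 0`, `[X₂,X₃] = h w₂₃(X₁,X₂)`, `[X₃,X₁] = h w₃₁(X₁,X₂)` hold, and the standard
monomials `X₁^a X₂^b X₃^c` are linearly independent over `k`.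
Here the variables of `S = k[z,u₁,u₂]` are indexed by `0 ↦ z`, `1 ↦ u₁`, `2 ↦ u₂`. -/
theorem weyl_realization {k : Type*} [Field k] [CharZero k] (h : k) (hh : h ≠ 0)
    (w₂₃ w₃₁ : MvPolynomial (Fin 2) k)
    (X₁ X₂ X₃ : Module.End k (MvPolynomial (Fin 3) k))
    (hX₁ : X₁ = ((pderiv 1 : Derivation k (MvPolynomial (Fin 3) k)
      (MvPolynomial (Fin 3) k)) : MvPolynomial (Fin 3) k →ₗ[k] MvPolynomial (Fin 3) k))
    (hX₂ : X₂ = ((pderiv 2 : Derivation k (MvPolynomial (Fin 3) k)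
      (MvPolynomial (Fin 3) k)) : MvPolynomial (Fin 3) k →ₗ[k] MvPolynomial (Fin 3) k))
    (hX₃ : X₃ = h • ((LinearMap.mulLeft k (X 2 : MvPolynomial (Fin 3) k)) *
          evalOps w₂₃ X₁ X₂ -
        (LinearMap.mulLeft k (X 1 : MvPolynomial (Fin 3) k)) * evalOps w₃₁ X₁ X₂) +
      LinearMap.mulLeft k (X 0 : MvPolynomial (Fin 3) k)) :
    (X₁ * X₂ - X₂ * X₁ = 0 ∧
      X₂ * X₃ - X₃ * X₂ = h • evalOps w₂₃ X₁ X₂ ∧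
      X₃ * X₁ - X₁ * X₃ = h • evalOps w₃₁ X₁ X₂) ∧
    LinearIndependent k (fun e : ℕ × ℕ × ℕ => X₁ ^ e.1 * X₂ ^ e.2.1 * X₃ ^ e.2.2) := by
  let D (i : Fin 3) : Module.End k (MvPolynomial (Fin 3) k) :=
    (pderiv i : Derivation k (MvPolynomial (Fin 3) k) (MvPolynomial (Fin 3) k)).toLinearMap
  let M (i : Fin 3) : Module.End k (MvPolynomial (Fin 3) k) := LinearMap.mulLeft k (X i)
  have hself (i : Fin 3) : D i * M i - M i * D i = 1 := by
    refine (Derivation.toLinearMap_mul_mulLeft_sub _ _).trans ?_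
    rw [pderiv_X_self, LinearMap.mulLeft_one]
    rfl
  have hne {i j : Fin 3} (hij : j ≠ i) : D i * M j - M j * D i = 0 := by
    refine (Derivation.toLinearMap_mul_mulLeft_sub _ _).trans ?_
    rw [pderiv_X_of_ne hij, LinearMap.mulLeft_zero_eq_zero]
  have hDD (i j : Fin 3) : Commute (D i) (D j) := commute_pderiv i j
  change X₁ = D 1 at hX₁
  change X₂ = D 2 at hX₂
  change X₃ = h • (M 2 * evalOps w₂₃ X₁ X₂ - M 1 * evalOps w₃₁ X₁ X₂) + M 0 at hX₃
  subst hX₁ hX₂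
  have hX₃comm (i : Fin 3) : D i * X₃ - X₃ * D i =
      h • ((D i * M 2 - M 2 * D i) * evalOps w₂₃ (D 1) (D 2) -
        (D i * M 1 - M 1 * D i) * evalOps w₃₁ (D 1) (D 2)) + (D i * M 0 - M 0 * D i) := by
    rw [hX₃]
    exact commutator_smul_mul_sub_mul_add h (.evalOps_right (hDD i 1) (hDD i 2))
      (.evalOps_right (hDD i 1) (hDD i 2)) _ _ _
  refine ⟨⟨sub_eq_zero.mpr (hDD 1 2).eq, ?_, ?_⟩, ?_⟩
  · rw [hX₃comm, hself, hne (by decide), hne (by decide)]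
    simp
  · rw [← neg_sub, hX₃comm, hself, hne (by decide), hne (by decide)]
    simp
  · have hneg (i : Fin 3) : -M i * D i - D i * -M i = 1 :=
      (neg_mul_sub_mul_neg _ _).trans (hself i)
    have hone : LinearIndependent k
        fun _ : Unit => (1 : Module.End k (MvPolynomial (Fin 3) k)) :=
      .of_subsingleton () one_ne_zero
    have hM₂D₁ : Commute (-M 2) (D 1) :=
      Commute.neg_left (sub_eq_zero.mp (hne (by decide))).symm
    have hX₁X₂ := (hone.mul_pow_of_commutator_eq_one (fun _ => .one_right (-M 1))
      (hneg 1)).mul_pow_of_commutator_eq_one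
        (fun p => (Commute.one_right _).mul_right (hM₂D₁.pow_right _)) (hneg 2)
    have hall := hX₁X₂.mul_pow_of_commutator_eq_one (d := D 0) (x := X₃)
      (fun p => ((Commute.one_right _).mul_right ((hDD 0 1).pow_right _)).mul_right
        ((hDD 0 2).pow_right _))
      (by rw [hX₃comm, hself, hne (by decide), hne (by decide)]; simp)
    simpa [Function.comp_def] using hall.comp
      (fun e : ℕ × ℕ × ℕ => ((((), e.1), e.2.1), e.2.2)) fun e f hef => by
        simpa [Prod.ext_iff, and_assoc] using hef
end
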